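/- Fix a prime g ≥ 3. For every ε > 0 there exists a constant C = C(g, ε) such that for all real X ≥ 2: (i) for all real Z with X^{1/(2g)} ≤ Z ≤ X one has T_g(Z;X) ≤ C · Z^{2g+4} X^{ε-1}; and (ii) if g = 3, for all real Z with X^{1/6} ≤ Z ≤ X one has T_3(Z;X) ≤ C · X^ε · ( Z^7 X^{-1/2} + Z^{12} X^{-3/2} ). -/

import Mathlib

/-- `Rg g d Z X` is the number of triples `(w, u, v)` of positive integers with
`W ≤ w < 4W`, `u ≤ U`, `v ≤ V` (where `W = Z²`, `U = 2^(g+1)·Z^g`,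
`V = 2^(g+1)·Z^g·X^(-1/2)`), `gcd(w, v) = 1`, such that `w = p₁p₂` for some
distinct primes `p₁, p₂ ∈ [Z, 2Z)`, and `4w^g = u² + d·v²`. -/
noncomputable def Rg (g d : ℕ) (Z X : ℝ) : ℕ :=
  Nat.card {t : ℕ × ℕ × ℕ //
    Z ^ 2 ≤ (t.1 : ℝ) ∧ (t.1 : ℝ) < 4 * Z ^ 2 ∧
    0 < t.2.1 ∧ (t.2.1 : ℝ) ≤ 2 ^ (g + 1) * Z ^ g ∧
    0 < t.2.2 ∧ (t.2.2 : ℝ) ≤ 2 ^ (g + 1) * Z ^ g * X ^ (-(1 : ℝ) / 2) ∧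
    Nat.gcd t.1 t.2.2 = 1 ∧
    (∃ p₁ p₂ : ℕ, p₁.Prime ∧ p₂.Prime ∧ p₁ ≠ p₂ ∧
      Z ≤ p₁ ∧ (p₁ : ℝ) < 2 * Z ∧ Z ≤ p₂ ∧ (p₂ : ℝ) < 2 * Z ∧ t.1 = p₁ * p₂) ∧
    4 * (t.1 : ℤ) ^ g = (t.2.1 : ℤ) ^ 2 + (d : ℤ) * (t.2.2 : ℤ) ^ 2}

/-- `Tg g Z X` is the sum over squarefree `d` with `X ≤ d < 2X` of
`R_g(d;Z)·(R_g(d;Z) − 1)`. -/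
noncomputable def Tg (g : ℕ) (Z X : ℝ) : ℝ :=
  ∑ d ∈ (Finset.range (⌈2 * X⌉₊ + 1)).filter
      (fun d : ℕ => Squarefree d ∧ X ≤ (d : ℝ) ∧ (d : ℝ) < 2 * X),
    (Rg g d Z X : ℝ) * ((Rg g d Z X : ℝ) - 1)

theorem card_cube_roots_le {m : ℕ} (hm : m ≠ 0) (T : Finset (ZMod m)ˣ)
    (hT : ∀ s ∈ T, ∀ t ∈ T, s ^ 3 = t ^ 3) : T.card ≤ m.divisors.card ^ 2 := by
  induction m using Nat.recOnPosPrimePosCoprime with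
  | zero => exact absurd rfl hm
  | one =>
    calc T.card ≤ Fintype.card (ZMod 1)ˣ := Finset.card_le_univ T
      _ ≤ _ := by simp
  | prime_pow p k hp hk =>
    rcases T.eq_empty_or_nonempty with rfl | ⟨t₀, ht₀⟩
    · simp
    have : NeZero (p ^ k) := ⟨hm⟩
    have hdiv : (p ^ k).divisors.card = k + 1 := by
      rw [Nat.divisors_prime_pow hp]; simp
    have hcard : T.card ≤ 3 := by
      by_cases hp2 : p = 2
      · subst hp2
        refine (Finset.card_le_one.2 fun s hs t ht => ?_).trans (by norm_num)
        have h3 : (s / t) ^ 3 = 1 := by rw [div_pow, hT s hs t ht, div_self']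
        have h2 : (s / t) ^ (2 ^ (k - 1)) = 1 := by
          have := ZMod.pow_totient (s / t)
          rwa [Nat.totient_prime_pow hp hk, Nat.add_one_sub_one, mul_one] at this
        have hg := pow_gcd_eq_one.2 ⟨h3, h2⟩
        have hc : Nat.gcd 3 (2 ^ (k - 1)) = 1 := Nat.Coprime.pow_right _ (by norm_num)
        rw [hc, pow_one] at hg
        exact div_eq_one.1 hg
      · have := ZMod.isCyclic_units_of_prime_pow p hp hp2 k
        refine le_trans ?_
          (IsCyclic.card_pow_eq_one_le (α := (ZMod (p ^ k))ˣ) (n := 3) (by norm_num))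
        refine Finset.card_le_card_of_injOn (fun t => t / t₀) ?_ ?_
        · intro t ht
          simp [div_pow, hT t ht t₀ ht₀]
        · intro s _ t _ h
          exact div_left_injective h
    rw [hdiv]
    nlinarith
  | coprime a b ha hb hab iha ihb =>
    let φ₁ : (ZMod (a * b))ˣ →* (ZMod a)ˣ :=
      Units.map ((RingHom.fst _ _).comp (ZMod.chineseRemainder hab).toRingHom).toMonoidHom
    let φ₂ : (ZMod (a * b))ˣ →* (ZMod b)ˣ :=
      Units.map ((RingHom.snd _ _).comp (ZMod.chineseRemainder hab).toRingHom).toMonoidHom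
    have h₁ := iha (by omega) (T.image φ₁) (by
      simp only [Finset.forall_mem_image]
      intro s hs t ht
      rw [← map_pow, ← map_pow, hT s hs t ht])
    have h₂ := ihb (by omega) (T.image φ₂) (by
      simp only [Finset.forall_mem_image]
      intro s hs t ht
      rw [← map_pow, ← map_pow, hT s hs t ht])
    calc T.card ≤ (T.image φ₁ ×ˢ T.image φ₂).card := by
          refine Finset.card_le_card_of_injOn (fun t => (φ₁ t, φ₂ t)) ?_ ?_
          · intro t ht
            simp only [Finset.coe_product, Finset.coe_image]
            exact ⟨Set.mem_image_of_mem _ ht, Set.mem_image_of_mem _ ht⟩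
          · intro s _ t _ h
            rw [Prod.mk.injEq] at h
            apply Units.ext
            apply (ZMod.chineseRemainder hab).injective
            exact Prod.ext (congrArg Units.val h.1) (congrArg Units.val h.2)
      _ ≤ a.divisors.card ^ 2 * b.divisors.card ^ 2 := by
          rw [Finset.card_product]; exact Nat.mul_le_mul h₁ h₂
      _ = _ := by rw [hab.card_divisors_mul, mul_pow]

theorem exists_card_divisors_le_rpow {η : ℝ} (hη : 0 < η) :
    ∃ C : ℝ, 1 ≤ C ∧ ∀ n : ℕ, n ≠ 0 → (n.divisors.card : ℝ) ≤ C * (n : ℝ) ^ η := by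
  obtain ⟨P, hP⟩ := exists_nat_ge ((2 : ℝ) ^ (1 / η))
  have hl : 0 < η * Real.log 2 := mul_pos hη (Real.log_pos (by norm_num))
  set c : ℝ := 1 + 1 / (η * Real.log 2) with hc
  have hc1 : 1 ≤ c := by rw [hc]; have := one_div_pos.2 hl; linarith
  refine ⟨c ^ P, one_le_pow₀ hc1, fun n hn => ?_⟩
  have key : ∀ p ∈ n.primeFactors, ((n.factorization p + 1 : ℕ) : ℝ) ≤
      (if p < P then c else 1) * ((p ^ n.factorization p : ℕ) : ℝ) ^ η := by
    intro p hp
    have hpp := Nat.prime_of_mem_primeFactors hp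
    set k := n.factorization p
    have hp2 : (2 : ℝ) ≤ p := by exact_mod_cast hpp.two_le
    have hpow : ((p ^ k : ℕ) : ℝ) ^ η = ((p : ℝ) ^ η) ^ k := by
      push_cast
      rw [← Real.rpow_natCast, ← Real.rpow_mul (by positivity), mul_comm,
        Real.rpow_mul (by positivity),
        Real.rpow_natCast]
    rw [hpow]
    split_ifs with h
    · have h1 : 1 + (k : ℝ) * (η * Real.log 2) ≤ ((p : ℝ) ^ η) ^ k := by
        calc 1 + (k : ℝ) * (η * Real.log 2) ≤ Real.exp (k * (η * Real.log 2)) := by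
              linarith [Real.add_one_le_exp (k * (η * Real.log 2))]
          _ = ((2 : ℝ) ^ η) ^ k := by
              rw [Real.rpow_def_of_pos (by norm_num), ← Real.exp_nat_mul]; ring_nf
          _ ≤ _ := by gcongr
      calc ((k + 1 : ℕ) : ℝ) ≤ c * (1 + (k : ℝ) * (η * Real.log 2)) := by
            rw [hc]; push_cast
            have : (1 + 1 / (η * Real.log 2)) * (1 + (k : ℝ) * (η * Real.log 2))
              = 1 + k * (η * Real.log 2) + 1 / (η * Real.log 2) + k := by
                field_simp
                ring
            rw [this]
            have := one_div_pos.2 hl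
            have : 0 ≤ k * (η * Real.log 2) := by positivity
            linarith
        _ ≤ _ := by gcongr
    · have h2 : (2 : ℝ) ≤ (p : ℝ) ^ η := by
        have hpP : (2 : ℝ) ^ (1 / η) ≤ p := hP.trans (by exact_mod_cast not_lt.1 h)
        calc (2 : ℝ) = ((2 : ℝ) ^ (1 / η)) ^ η := by
              rw [← Real.rpow_mul (by norm_num), one_div_mul_cancel hη.ne', Real.rpow_one]
          _ ≤ _ := by gcongr
      rw [one_mul]
      calc ((k + 1 : ℕ) : ℝ) ≤ (2 : ℝ) ^ k := by exact_mod_cast Nat.lt_two_pow_self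
        _ ≤ _ := by gcongr
  have hfac : (n : ℝ) ^ η = ∏ p ∈ n.primeFactors, ((p ^ n.factorization p : ℕ) : ℝ) ^ η := by
    rw [Real.finsetProd_rpow _ _ (fun _ _ => by positivity)]
    congr 1
    conv_lhs => rw [← Nat.prod_factorization_pow_eq_self hn]
    rw [Finsupp.prod, Nat.support_factorization]
    push_cast
    rfl
  rw [Nat.card_divisors hn, hfac]
  push_cast
  calc ∏ p ∈ n.primeFactors, ((n.factorization p : ℝ) + 1)
      ≤ ∏ p ∈ n.primeFactors, ((if p < P then c else 1) * ((p ^ n.factorization p : ℕ) : ℝ) ^ η) :=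
        Finset.prod_le_prod (fun _ _ => by positivity) (fun p hp => by
          have := key p hp; push_cast at this ⊢; exact this)
    _ = (∏ p ∈ n.primeFactors, (if p < P then c else 1)) *
          ∏ p ∈ n.primeFactors, ((p ^ n.factorization p : ℕ) : ℝ) ^ η := Finset.prod_mul_distrib
    _ ≤ c ^ P * ∏ p ∈ n.primeFactors, ((p ^ n.factorization p : ℕ) : ℝ) ^ η := by
        gcongr
        rw [← Finset.prod_filter, Finset.prod_const]
        refine pow_le_pow_right₀ hc1 ?_
        calc _ ≤ (Finset.range P).card := Finset.card_le_card (fun p hp => by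
              simp only [Finset.mem_filter] at hp; exact Finset.mem_range.2 hp.2)
          _ = P := Finset.card_range P
    _ = _ := by push_cast; rfl

/-- `t = (w, u, v)` is a solution of `4 w ^ g = u ^ 2 + d v ^ 2` in positive integers with
`gcd(w, v) = 1`, lying in the box `w ≤ S`, `u ≤ U`, `v ≤ V`. -/
structure IsRep (g S U V d : ℕ) (t : ℕ × ℕ × ℕ) : Prop where
  w_pos : 0 < t.1
  w_le : t.1 ≤ S
  u_pos : 0 < t.2.1
  u_le : t.2.1 ≤ U
  v_pos : 0 < t.2.2
  v_le : t.2.2 ≤ V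
  coprime : t.1.Coprime t.2.2
  eqn : 4 * t.1 ^ g = t.2.1 ^ 2 + d * t.2.2 ^ 2

/-- A pair of distinct solutions, in the same box, belonging to the same `d`. -/
def IsRepPair (g S U V : ℕ) (p : (ℕ × ℕ × ℕ) × (ℕ × ℕ × ℕ)) : Prop :=
  p.1 ≠ p.2 ∧ ∃ d, IsRep g S U V d p.1 ∧ IsRep g S U V d p.2

namespace IsRep

variable {g S U V d : ℕ} {s t : ℕ × ℕ × ℕ}

theorem mul_eq (hs : IsRep g S U V d s) (ht : IsRep g S U V d t) :
    ((s.2.1 : ℤ) * t.2.2 - t.2.1 * s.2.2) * (s.2.1 * t.2.2 + t.2.1 * s.2.2) =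
      4 * ((s.1 : ℤ) ^ g * t.2.2 ^ 2 - (t.1 : ℤ) ^ g * s.2.2 ^ 2) := by
  have h₁ : (4 : ℤ) * s.1 ^ g = s.2.1 ^ 2 + d * s.2.2 ^ 2 := by exact_mod_cast hs.eqn
  have h₂ : (4 : ℤ) * t.1 ^ g = t.2.1 ^ 2 + d * t.2.2 ^ 2 := by exact_mod_cast ht.eqn
  linear_combination (-(t.2.2 : ℤ) ^ 2) * h₁ + (s.2.2 : ℤ) ^ 2 * h₂

theorem eq_of_pow_mul_eq (hg : g ≠ 0) (hs : IsRep g S U V d s) (ht : IsRep g S U V d t)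
    (h : s.1 ^ g * t.2.2 ^ 2 = t.1 ^ g * s.2.2 ^ 2) : s = t := by
  obtain ⟨w₁, u₁, v₁⟩ := s
  obtain ⟨w₂, u₂, v₂⟩ := t
  have cs := hs.coprime
  have ct := ht.coprime
  have es := hs.eqn
  have et := ht.eqn
  have ps := hs.w_pos
  simp only at h cs ct es et ps
  have hw : w₁ = w₂ := by
    apply Nat.dvd_antisymm
    · rw [← Nat.pow_dvd_pow_iff hg]
      exact (Nat.Coprime.pow g 2 cs).dvd_of_dvd_mul_right (h ▸ dvd_mul_right _ _)
    · rw [← Nat.pow_dvd_pow_iff hg]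
      exact (Nat.Coprime.pow g 2 ct).dvd_of_dvd_mul_right (h ▸ dvd_mul_right _ _)
  subst hw
  have hv : v₁ = v₂ :=
    (Nat.pow_left_injective two_ne_zero (Nat.eq_of_mul_eq_mul_left (by positivity) h)).symm
  subst hv
  have hu : u₁ = u₂ := Nat.pow_left_injective two_ne_zero (by simp only; omega)
  rw [hu]

theorem sub_ne_zero (hg : g ≠ 0) (hs : IsRep g S U V d s) (ht : IsRep g S U V d t) (hst : s ≠ t) :
    4 * ((s.1 : ℤ) ^ g * t.2.2 ^ 2 - (t.1 : ℤ) ^ g * s.2.2 ^ 2) ≠ 0 := fun h =>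
  hst <| eq_of_pow_mul_eq hg hs ht <| by
    have : (s.1 : ℤ) ^ g * t.2.2 ^ 2 = (t.1 : ℤ) ^ g * s.2.2 ^ 2 := by linarith
    exact_mod_cast this

end IsRep

theorem card_repPairs_le {g S U V D : ℕ} (hg : g ≠ 0)
    (hD : ∀ n : ℕ, n ≠ 0 → n ≤ 8 * S ^ g * V ^ 2 + U * V → n.divisors.card ≤ D)
    (P : Finset ((ℕ × ℕ × ℕ) × (ℕ × ℕ × ℕ))) (hP : ∀ p ∈ P, IsRepPair g S U V p)
    (A B : Finset (ℕ × ℕ)) (hA : ∀ p ∈ P, (p.1.1, p.2.1) ∈ A)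
    (hB : ∀ p ∈ P, (p.1.2.2, p.2.2.2) ∈ B) : P.card ≤ D * (A.card * B.card) := by
  rw [← Finset.card_product]
  refine Finset.card_le_mul_card_image_of_maps_to
    (f := fun p => ((p.1.1, p.2.1), (p.1.2.2, p.2.2.2)))
    (fun p hp => Finset.mem_product.2 ⟨hA p hp, hB p hp⟩) D ?_
  rintro ⟨⟨w₁, w₂⟩, ⟨v₁, v₂⟩⟩ -
  set F := P.filter (fun p => ((p.1.1, p.2.1), (p.1.2.2, p.2.2.2)) = ((w₁, w₂), (v₁, v₂))) with hF
  rcases F.eq_empty_or_nonempty with hE | ⟨p₀, hp₀⟩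
  · simp [hE]
  set N : ℤ := 4 * ((w₁ : ℤ) ^ g * v₂ ^ 2 - (w₂ : ℤ) ^ g * v₁ ^ 2) with hN
  have hmem : ∀ p ∈ F, IsRepPair g S U V p ∧
      p.1.1 = w₁ ∧ p.2.1 = w₂ ∧ p.1.2.2 = v₁ ∧ p.2.2.2 = v₂ := by
    intro p hp
    simp only [hF, Finset.mem_filter, Prod.mk.injEq] at hp
    exact ⟨hP p hp.1, hp.2.1.1, hp.2.1.2, hp.2.2.1, hp.2.2.2⟩
  have hmul : ∀ p ∈ F, ((p.1.2.1 : ℤ) * v₂ - p.2.2.1 * v₁) * (p.1.2.1 * v₂ + p.2.2.1 * v₁) = N := by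
    intro p hp
    obtain ⟨⟨_, d, h₁, h₂⟩, rfl, rfl, rfl, rfl⟩ := hmem p hp
    exact h₁.mul_eq h₂
  obtain ⟨⟨hne, d, h₁, h₂⟩, e₁, e₂, e₃, e₄⟩ := hmem p₀ hp₀
  have hN0 : N ≠ 0 := by
    have := h₁.sub_ne_zero hg h₂ hne
    rwa [e₁, e₂, e₃, e₄] at this
  have hv₁ : 0 < v₁ := e₃ ▸ h₁.v_pos
  have hv₂ : 0 < v₂ := e₄ ▸ h₂.v_pos
  have hw₁ : w₁ ≤ S := e₁ ▸ h₁.w_le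
  have hw₂ : w₂ ≤ S := e₂ ▸ h₂.w_le
  have hv₁' : v₁ ≤ V := e₃ ▸ h₁.v_le
  have hv₂' : v₂ ≤ V := e₄ ▸ h₂.v_le
  have hNle : N.natAbs ≤ 8 * S ^ g * V ^ 2 + U * V := by
    have b₁ : w₁ ^ g * v₂ ^ 2 ≤ S ^ g * V ^ 2 := by gcongr
    have b₂ : w₂ ^ g * v₁ ^ 2 ≤ S ^ g * V ^ 2 := by gcongr
    have : N = 4 * (((w₁ ^ g * v₂ ^ 2 : ℕ) : ℤ) - ((w₂ ^ g * v₁ ^ 2 : ℕ) : ℤ)) := by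
      rw [hN]; push_cast; ring
    have h8 : 8 * S ^ g * V ^ 2 = 8 * (S ^ g * V ^ 2) := by ring
    have := Nat.zero_le (U * V)
    omega
  refine le_trans ?_ (hD N.natAbs (by omega) hNle)
  refine Finset.card_le_card_of_injOn (fun p => p.1.2.1 * v₂ + p.2.2.1 * v₁) ?_ ?_
  · intro p hp
    simp only [Finset.mem_coe, Nat.mem_divisors]
    refine ⟨?_, by omega⟩
    rw [← Int.natCast_dvd]
    exact ⟨(p.1.2.1 : ℤ) * v₂ - p.2.2.1 * v₁, by rw [← hmul p hp]; push_cast; ring⟩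
  · intro p hp q hq hpq
    have hp' := hmul p hp
    have hq' := hmul q hq
    obtain ⟨⟨w, u, v⟩, ⟨w', u', v'⟩⟩ := p
    obtain ⟨⟨x, y, z⟩, ⟨x', y', z'⟩⟩ := q
    obtain ⟨_, rfl, rfl, rfl, rfl⟩ := hmem _ hp
    obtain ⟨_, rfl, rfl, rfl, rfl⟩ := hmem _ hq
    simp only at hpq hp' hq' ⊢
    have hpq' : (u : ℤ) * z' + u' * z = y * z' + y' * z := by exact_mod_cast hpq
    have hb : (u : ℤ) * z' + u' * z ≠ 0 := fun h => hN0 (by rw [← hp', h, mul_zero])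
    have hsub : (u : ℤ) * z' - u' * z = y * z' - y' * z := by
      rw [← hpq', ← hp'] at hq'
      exact (mul_right_cancel₀ hb hq').symm
    have e1 : (u : ℤ) * z' = y * z' := by linarith
    have e2 : (u' : ℤ) * z = y' * z := by linarith
    have hu : u = y := Nat.eq_of_mul_eq_mul_right hv₂ (by exact_mod_cast e1)
    have hu' : u' = y' := Nat.eq_of_mul_eq_mul_right hv₁ (by exact_mod_cast e2)
    rw [hu, hu']

theorem exists_dvd_of_dvd_four_mul {k : ℕ} (hk : k ≠ 0) :
    ∃ m : ℕ, m ≠ 0 ∧ m ∣ k ∧ k ∣ 4 * m ∧ ∀ n : ℤ, (k : ℤ) ∣ 4 * n → (m : ℤ) ∣ n := by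
  obtain ⟨m, e, hco, hm, he⟩ := Nat.exists_coprime k 4
  set c := k.gcd 4
  have hc : c ≠ 0 := by rintro h; rw [h, mul_zero] at hm; exact hk hm
  refine ⟨m, ?_, ⟨c, hm⟩, ⟨e, ?_⟩, fun n hn => ?_⟩
  · rintro rfl; exact hk (by rw [hm, zero_mul])
  · rw [hm, he]; ring
  · have h4 : (4 : ℤ) = e * c := by exact_mod_cast he
    have hk' : (k : ℤ) = m * c := by exact_mod_cast hm
    rw [h4, hk', mul_right_comm] at hn
    have := Int.dvd_of_mul_dvd_mul_right (by exact_mod_cast hc) hn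
    exact (Nat.isCoprime_iff_coprime.2 hco).dvd_of_dvd_mul_left this

theorem isCoprime_cube_mul_sq_sub {w₁ w₂ r₁ r₂ : ℤ} (hw : IsCoprime w₁ w₂) (h₁ : IsCoprime w₁ r₁)
    (h₂ : IsCoprime w₂ r₂) (hr : IsCoprime r₁ r₂) :
    IsCoprime (w₁ ^ 3 * r₂ ^ 2 - w₂ ^ 3 * r₁ ^ 2) w₁ ∧
      IsCoprime (w₁ ^ 3 * r₂ ^ 2 - w₂ ^ 3 * r₁ ^ 2) w₂ ∧
      IsCoprime (w₁ ^ 3 * r₂ ^ 2 - w₂ ^ 3 * r₁ ^ 2) r₁ := by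
  refine ⟨?_, ?_, ?_⟩
  · have h : IsCoprime (-(w₂ ^ 3 * r₁ ^ 2)) w₁ :=
      (hw.symm.pow_left.mul_left h₁.symm.pow_left).neg_left
    rw [show w₁ ^ 3 * r₂ ^ 2 - w₂ ^ 3 * r₁ ^ 2 =
      -(w₂ ^ 3 * r₁ ^ 2) + w₁ * (w₁ ^ 2 * r₂ ^ 2) by ring]
    exact h.add_mul_left_left _
  · have h : IsCoprime (w₁ ^ 3 * r₂ ^ 2) w₂ := hw.pow_left.mul_left h₂.symm.pow_left
    rw [show w₁ ^ 3 * r₂ ^ 2 - w₂ ^ 3 * r₁ ^ 2 =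
      w₁ ^ 3 * r₂ ^ 2 + w₂ * (-(w₂ ^ 2 * r₁ ^ 2)) by ring]
    exact h.add_mul_left_left _
  · have h : IsCoprime (w₁ ^ 3 * r₂ ^ 2) r₁ := h₁.pow_left.mul_left hr.symm.pow_left
    rw [show w₁ ^ 3 * r₂ ^ 2 - w₂ ^ 3 * r₁ ^ 2 = w₁ ^ 3 * r₂ ^ 2 + r₁ * (-(w₂ ^ 3 * r₁)) by ring]
    exact h.add_mul_left_left _

theorem dvd_four_mul_sub {r₁ r₂ h W W' u₁ u₂ u₁' u₂' d d' : ℤ} (hr : IsCoprime r₁ r₂)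
    (e : 4 * W = u₁ ^ 2 + d * (r₁ * h) ^ 2) (e' : 4 * W' = u₁' ^ 2 + d' * (r₁ * h) ^ 2)
    (ha : u₁ * r₂ - u₂ * r₁ = u₁' * r₂ - u₂' * r₁) : r₁ ∣ 4 * (W - W') := by
  have : r₁ ∣ r₂ ^ 2 * (4 * (W - W')) := by
    refine ⟨d * h ^ 2 * r₁ * r₂ ^ 2 - d' * h ^ 2 * r₁ * r₂ ^ 2
      + (u₂ - u₂') * (u₁ * r₂ + u₁' * r₂), ?_⟩
    linear_combination r₂ ^ 2 * e - r₂ ^ 2 * e' + (u₁ * r₂ + u₁' * r₂) * ha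
  exact hr.pow_right.dvd_of_dvd_mul_left this

/-- The class of `n` in the unit group of `ZMod m`, and `1` if `n` is not coprime to `m`. -/
def residueUnit (m n : ℕ) : (ZMod m)ˣ :=
  if h : n.Coprime m then ZMod.unitOfCoprime n h else 1

theorem coe_residueUnit {m n : ℕ} (h : n.Coprime m) : (residueUnit m n : ZMod m) = n := by
  rw [residueUnit, dif_pos h, ZMod.coe_unitOfCoprime]

/-- The divisibility conditions satisfied by the difference `(x, y)` of two points `(w₁, w₂)`
attached to the same `v₁`, `v₂` and `a = u₁ v₂ - u₂ v₁`, and to the same residue classes. -/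
def IsDiff (v₁ v₂ : ℕ) (a x y : ℤ) : Prop :=
  (v₁ : ℤ) ∣ 4 * v₂ * x ∧ (v₂ : ℤ) ∣ 4 * v₁ * y ∧
    a ∣ 4 * ((v₁ : ℤ) ^ 2 * y ^ 3 - (v₂ : ℤ) ^ 2 * x ^ 3)

theorem card_fiber_le {S U V D M v₁ v₂ : ℕ} {a : ℤ} (ha : a ≠ 0)
    (hD : ∀ n : ℕ, n ≠ 0 → n ≤ 8 * S ^ 3 * V ^ 2 + U * V → n.divisors.card ≤ D)
    (F : Finset (ℕ × ℕ))
    (hF : ∀ p ∈ F, p.1.Coprime p.2 ∧ ∃ d u₁ u₂ : ℕ, IsRep 3 S U V d (p.1, u₁, v₁) ∧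
      IsRep 3 S U V d (p.2, u₂, v₂) ∧ (u₁ : ℤ) * v₂ - u₂ * v₁ = a)
    (hM : ∀ G ⊆ F, (∀ p ∈ G, ∀ q ∈ G, IsDiff v₁ v₂ a ((p.1 : ℤ) - q.1) ((p.2 : ℤ) - q.2)) →
      G.card ≤ M) : F.card ≤ M * D ^ 6 := by
  classical
  rcases F.eq_empty_or_nonempty with rfl | ⟨p₀, hp₀⟩
  · simp
  obtain ⟨-, d₀, x₀, y₀, h₁, h₂, ha₀⟩ := hF p₀ hp₀
  have hv₁ : 0 < v₁ := h₁.v_pos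
  have hv₂ : 0 < v₂ := h₂.v_pos
  have hv₁V : v₁ ≤ V := h₁.v_le
  have hv₂V : v₂ ≤ V := h₂.v_le
  have hx₀ : x₀ ≤ U := h₁.u_le
  have hy₀ : y₀ ≤ U := h₂.u_le
  have hSpos : 0 < S := h₁.w_pos.trans_le h₁.w_le
  obtain ⟨r₁, r₂, hr, e₁, e₂⟩ := Nat.exists_coprime v₁ v₂
  set h := v₁.gcd v₂
  have hh : (h : ℤ) ≠ 0 := by
    rintro h0
    rw [Nat.cast_eq_zero.1 h0, mul_zero] at e₁
    omega
  have hr₁ : r₁ ≠ 0 := by rintro rfl; omega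
  have hr₂ : r₂ ≠ 0 := by rintro rfl; omega
  have e₁' : (v₁ : ℤ) = r₁ * h := by exact_mod_cast e₁
  have e₂' : (v₂ : ℤ) = r₂ * h := by exact_mod_cast e₂
  have hrI : IsCoprime (r₁ : ℤ) r₂ := Nat.isCoprime_iff_coprime.2 hr
  obtain ⟨a', rfl⟩ : (h : ℤ) ∣ a := ⟨x₀ * r₂ - y₀ * r₁, by rw [← ha₀, e₁', e₂']; ring⟩
  have ha' : a' ≠ 0 := right_ne_zero_of_mul ha
  have ha'U : a'.natAbs ≤ U * V := by
    have : (h * a').natAbs ≤ U * V := by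
      have b₁ : x₀ * v₂ ≤ U * V := by gcongr
      have b₂ : y₀ * v₁ ≤ U * V := by gcongr
      have : (h * a' : ℤ) = ((x₀ * v₂ : ℕ) : ℤ) - ((y₀ * v₁ : ℕ) : ℤ) := by
        rw [← ha₀]; push_cast; ring
      omega
    rw [Int.natAbs_mul, Int.natAbs_natCast] at this
    exact (Nat.le_mul_of_pos_left _ (by omega)).trans this
  obtain ⟨m₁, hm₁0, hm₁r, hm₁4, hm₁⟩ := exists_dvd_of_dvd_four_mul hr₁
  obtain ⟨m₂, hm₂0, hm₂r, hm₂4, hm₂⟩ := exists_dvd_of_dvd_four_mul hr₂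
  obtain ⟨m₃, hm₃0, hm₃r, hm₃4, hm₃⟩ := exists_dvd_of_dvd_four_mul (Int.natAbs_ne_zero.2 ha')
  have red : ∀ p ∈ F, ∃ d u₁ u₂ : ℕ, 4 * (p.1 : ℤ) ^ 3 = u₁ ^ 2 + d * (r₁ * h) ^ 2 ∧
      4 * (p.2 : ℤ) ^ 3 = u₂ ^ 2 + d * (r₂ * h) ^ 2 ∧ (u₁ : ℤ) * r₂ - u₂ * r₁ = a' ∧
      (m₃ : ℤ) ∣ (p.1 : ℤ) ^ 3 * r₂ ^ 2 - (p.2 : ℤ) ^ 3 * r₁ ^ 2 ∧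
      p.1.Coprime m₁ ∧ p.2.Coprime m₂ ∧ p.1.Coprime m₃ ∧ p.2.Coprime m₃ ∧ r₁.Coprime m₃ := by
    intro p hp
    obtain ⟨hco, d, u₁, u₂, h₁, h₂, hau⟩ := hF p hp
    have hmul := h₁.mul_eq h₂
    have c₁ : p.1.Coprime v₁ := h₁.coprime
    have c₂ : p.2.Coprime v₂ := h₂.coprime
    have q₁ : 4 * (p.1 : ℤ) ^ 3 = u₁ ^ 2 + d * v₁ ^ 2 := by exact_mod_cast h₁.eqn
    have q₂ : 4 * (p.2 : ℤ) ^ 3 = u₂ ^ 2 + d * v₂ ^ 2 := by exact_mod_cast h₂.eqn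
    simp only at hmul
    have c₁' : p.1.Coprime r₁ := c₁.coprime_dvd_right ⟨h, e₁⟩
    have c₂' : p.2.Coprime r₂ := c₂.coprime_dvd_right ⟨h, e₂⟩
    have hau' : (u₁ : ℤ) * r₂ - u₂ * r₁ = a' := by
      apply mul_left_cancel₀ hh
      rw [← hau, e₁', e₂']; ring
    have hdvd : (m₃ : ℤ) ∣ (p.1 : ℤ) ^ 3 * r₂ ^ 2 - (p.2 : ℤ) ^ 3 * r₁ ^ 2 := by
      apply hm₃
      rw [Int.natAbs_dvd]
      refine ⟨u₁ * r₂ + u₂ * r₁, ?_⟩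
      apply mul_left_cancel₀ (pow_ne_zero 2 hh)
      rw [e₁', e₂'] at hmul
      rw [← hau']
      linear_combination -hmul
    obtain ⟨k₁, k₂, k₃⟩ := isCoprime_cube_mul_sq_sub (Nat.isCoprime_iff_coprime.2 hco)
      (Nat.isCoprime_iff_coprime.2 c₁') (Nat.isCoprime_iff_coprime.2 c₂') hrI
    refine ⟨d, u₁, u₂, by rw [q₁, e₁'], by rw [q₂, e₂'], hau', hdvd,
      c₁'.coprime_dvd_right hm₁r, c₂'.coprime_dvd_right hm₂r, ?_, ?_, ?_⟩
    · exact Nat.isCoprime_iff_coprime.1 (k₁.of_isCoprime_of_dvd_left hdvd).symm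
    · exact Nat.isCoprime_iff_coprime.1 (k₂.of_isCoprime_of_dvd_left hdvd).symm
    · exact Nat.isCoprime_iff_coprime.1 (k₃.of_isCoprime_of_dvd_left hdvd).symm
  let φ₁ : ℕ × ℕ → (ZMod m₁)ˣ := fun p => residueUnit m₁ p.1
  let φ₂ : ℕ × ℕ → (ZMod m₂)ˣ := fun p => residueUnit m₂ p.2
  let φ₃ : ℕ × ℕ → (ZMod m₃)ˣ := fun p => residueUnit m₃ p.2 * (residueUnit m₃ p.1)⁻¹
  have hφ₃ : ∀ p ∈ F, (p.2 : ZMod m₃) = φ₃ p * p.1 ∧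
      (r₁ : ZMod m₃) ^ 2 * (φ₃ p : ZMod m₃) ^ 3 = (r₂ : ZMod m₃) ^ 2 := by
    intro p hp
    obtain ⟨d, u₁, u₂, -, -, -, hdvd, -, -, c₁, c₂, -⟩ := red p hp
    have hlam : (p.2 : ZMod m₃) = φ₃ p * p.1 := by
      rw [← coe_residueUnit c₁, ← coe_residueUnit c₂, ← Units.val_mul]
      simp [φ₃]
    refine ⟨hlam, ?_⟩
    have hz : ((p.1 : ZMod m₃)) ^ 3 * r₂ ^ 2 - (p.2 : ZMod m₃) ^ 3 * r₁ ^ 2 = 0 := by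
      have := (ZMod.intCast_zmod_eq_zero_iff_dvd _ m₃).2 hdvd
      exact_mod_cast this
    have hu : IsUnit ((p.1 : ZMod m₃) ^ 3) := by
      rw [← coe_residueUnit c₁]
      exact (Units.isUnit _).pow 3
    apply hu.mul_left_cancel
    rw [hlam] at hz
    linear_combination -hz
  have cube : ∀ p ∈ F, ∀ q ∈ F,
      φ₁ p ^ 3 = φ₁ q ^ 3 ∧ φ₂ p ^ 3 = φ₂ q ^ 3 ∧ φ₃ p ^ 3 = φ₃ q ^ 3 := by
    intro p hp q hq
    obtain ⟨d, u₁, u₂, f₁, f₂, f₃, -, c₁, c₂, -, -, c₃⟩ := red p hp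
    obtain ⟨d', u₁', u₂', f₁', f₂', f₃', -, c₁', c₂', -⟩ := red q hq
    refine ⟨Units.ext ?_, Units.ext ?_, Units.ext ?_⟩
    · have := hm₁ _ (dvd_four_mul_sub hrI f₁ f₁' (f₃.trans f₃'.symm))
      have := (ZMod.intCast_zmod_eq_zero_iff_dvd _ m₁).2 this
      push_cast at this ⊢
      simp only [φ₁, coe_residueUnit c₁, coe_residueUnit c₁']
      exact sub_eq_zero.1 this
    · have := hm₂ _ (dvd_four_mul_sub (u₂ := u₁) (u₂' := u₁') hrI.symm f₂ f₂' (by linarith))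
      have := (ZMod.intCast_zmod_eq_zero_iff_dvd _ m₂).2 this
      push_cast at this ⊢
      simp only [φ₂, coe_residueUnit c₂, coe_residueUnit c₂']
      exact sub_eq_zero.1 this
    · have hu : IsUnit ((r₁ : ZMod m₃) ^ 2) := by
        rw [← coe_residueUnit c₃]
        exact (Units.isUnit _).pow 2
      apply hu.mul_left_cancel
      push_cast
      rw [(hφ₃ p hp).2, (hφ₃ q hq).2]
  have hr₁V : r₁ ≤ V := (Nat.le_of_dvd hv₁ ⟨h, e₁⟩).trans hv₁V
  have hr₂V : r₂ ≤ V := (Nat.le_of_dvd hv₂ ⟨h, e₂⟩).trans hv₂V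
  have hVB : V ≤ 8 * S ^ 3 * V ^ 2 := by
    calc V = 1 * V := (one_mul V).symm
      _ ≤ (8 * S ^ 3 * V) * V := Nat.mul_le_mul_right _ (Nat.mul_pos (by positivity) (by omega))
      _ = _ := by ring
  have card_img : ∀ (m : ℕ) (_ : m ≠ 0) (_ : m ≤ 8 * S ^ 3 * V ^ 2 + U * V)
      (φ : ℕ × ℕ → (ZMod m)ˣ) (_ : ∀ p ∈ F, ∀ q ∈ F, φ p ^ 3 = φ q ^ 3),
      (F.image φ).card ≤ D ^ 2 := by
    intro m hm hmB φ hφ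
    refine (card_cube_roots_le hm _ ?_).trans (Nat.pow_le_pow_left (hD m hm hmB) 2)
    simpa only [Finset.forall_mem_image] using hφ
  have i₁ := card_img m₁ hm₁0 (by have := Nat.le_of_dvd (by omega) hm₁r; omega) φ₁
    fun p hp q hq => (cube p hp q hq).1
  have i₂ := card_img m₂ hm₂0 (by have := Nat.le_of_dvd (by omega) hm₂r; omega) φ₂
    fun p hp q hq => (cube p hp q hq).2.1
  have i₃ := card_img m₃ hm₃0 (by have := Nat.le_of_dvd (by omega) hm₃r; omega) φ₃
    fun p hp q hq => (cube p hp q hq).2.2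
  refine (Finset.card_le_mul_card_image_of_maps_to (f := fun p => (φ₁ p, φ₂ p, φ₃ p))
    (t := F.image φ₁ ×ˢ F.image φ₂ ×ˢ F.image φ₃) (fun p hp => ?_) M ?_).trans ?_
  · simp only [Finset.mem_product]
    exact ⟨Finset.mem_image_of_mem _ hp, Finset.mem_image_of_mem _ hp, Finset.mem_image_of_mem _ hp⟩
  · rintro c -
    refine hM _ (Finset.filter_subset _ _) fun p hp q hq => ?_
    rw [Finset.mem_filter] at hp hq
    have hpq := hp.2.trans hq.2.symm
    replace hp := hp.1
    replace hq := hq.1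
    simp only [Prod.mk.injEq] at hpq
    obtain ⟨g₁, g₂, g₃⟩ := hpq
    obtain ⟨-, -, -, -, -, -, -, c₁, c₂, -, -, -⟩ := red p hp
    obtain ⟨-, -, -, -, -, -, -, c₁', c₂', -, -, -⟩ := red q hq
    have t₁ : (r₁ : ℤ) ∣ 4 * ((p.1 : ℤ) - q.1) := by
      have : (m₁ : ℤ) ∣ (p.1 : ℤ) - q.1 := by
        rw [← ZMod.intCast_zmod_eq_zero_iff_dvd]
        push_cast
        rw [← coe_residueUnit c₁, ← coe_residueUnit c₁']
        exact sub_eq_zero.2 (congrArg Units.val g₁)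
      exact dvd_trans (b := (4 * m₁ : ℤ)) (by exact_mod_cast hm₁4) (mul_dvd_mul_left 4 this)
    have t₂ : (r₂ : ℤ) ∣ 4 * ((p.2 : ℤ) - q.2) := by
      have : (m₂ : ℤ) ∣ (p.2 : ℤ) - q.2 := by
        rw [← ZMod.intCast_zmod_eq_zero_iff_dvd]
        push_cast
        rw [← coe_residueUnit c₂, ← coe_residueUnit c₂']
        exact sub_eq_zero.2 (congrArg Units.val g₂)
      exact dvd_trans (b := (4 * m₂ : ℤ)) (by exact_mod_cast hm₂4) (mul_dvd_mul_left 4 this)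
    have t₃ :
        a' ∣ 4 * ((r₁ : ℤ) ^ 2 * ((p.2 : ℤ) - q.2) ^ 3 - (r₂ : ℤ) ^ 2 * ((p.1 : ℤ) - q.1) ^ 3) := by
      have : (m₃ : ℤ) ∣
          (r₁ : ℤ) ^ 2 * ((p.2 : ℤ) - q.2) ^ 3 - (r₂ : ℤ) ^ 2 * ((p.1 : ℤ) - q.1) ^ 3 := by
        rw [← ZMod.intCast_zmod_eq_zero_iff_dvd]
        push_cast
        rw [(hφ₃ p hp).1, (hφ₃ q hq).1, ← g₃]
        linear_combination (((p.1 : ZMod m₃) - q.1) ^ 3) * (hφ₃ p hp).2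
      refine dvd_trans (b := (4 * m₃ : ℤ)) ?_ (mul_dvd_mul_left 4 this)
      rw [← Int.natAbs_dvd]
      exact_mod_cast hm₃4
    refine ⟨?_, ?_, ?_⟩
    · rw [e₁', e₂']
      rw [show (4 : ℤ) * (r₂ * h) * (p.1 - q.1) = r₂ * (4 * (p.1 - q.1) * h) by ring]
      exact (mul_dvd_mul_right t₁ (h : ℤ)).mul_left r₂
    · rw [e₁', e₂']
      rw [show (4 : ℤ) * (r₁ * h) * (p.2 - q.2) = r₁ * (4 * (p.2 - q.2) * h) by ring]
      exact (mul_dvd_mul_right t₂ (h : ℤ)).mul_left r₁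
    · rw [e₁', e₂']
      rw [show (4 : ℤ) * ((r₁ * h) ^ 2 * (p.2 - q.2) ^ 3 - (r₂ * h) ^ 2 * (p.1 - q.1) ^ 3) =
        h * (h * (4 * (r₁ ^ 2 * (p.2 - q.2) ^ 3 - r₂ ^ 2 * (p.1 - q.1) ^ 3))) by ring]
      exact (mul_dvd_mul_left (h : ℤ) t₃).mul_left h
  · rw [Finset.card_product, Finset.card_product]
    gcongr
    calc _ ≤ D ^ 2 * (D ^ 2 * D ^ 2) := by gcongr
      _ = D ^ 6 := by ring

/-- The sup norm of an integer vector. -/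
def supAbs (z : ℤ × ℤ) : ℕ := max z.1.natAbs z.2.natAbs

/-- The nonzero integer vectors of sup norm at most `S`. -/
noncomputable def punctured (S : ℕ) : Finset (ℤ × ℤ) :=
  (Finset.Icc (-(S : ℤ)) S ×ˢ Finset.Icc (-(S : ℤ)) S).erase 0

theorem supAbs_pos {z : ℤ × ℤ} (hz : z ≠ 0) : 0 < supAbs z := by
  obtain ⟨x, y⟩ := z
  have : ¬ (x = 0 ∧ y = 0) := fun h => hz (by rw [h.1, h.2]; rfl)
  simp only [supAbs]
  omega

theorem mem_punctured {S : ℕ} {z : ℤ × ℤ} : z ∈ punctured S ↔ z ≠ 0 ∧ supAbs z ≤ S := by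
  simp only [punctured, Finset.mem_erase, Finset.mem_product, Finset.mem_Icc, supAbs]
  refine and_congr_right fun _ => ?_
  omega

theorem card_supAbs_eq_le (S m : ℕ) (hm : m ≠ 0) :
    ((punctured S).filter (fun z => supAbs z = m)).card ≤ 12 * m := by
  have hsub : (punctured S).filter (fun z => supAbs z = m) ⊆
      (({(m : ℤ), -(m : ℤ)} : Finset ℤ) ×ˢ Finset.Icc (-(m : ℤ)) m) ∪
        (Finset.Icc (-(m : ℤ)) m ×ˢ ({(m : ℤ), -(m : ℤ)} : Finset ℤ)) := by
    intro z hz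
    have hz := (Finset.mem_filter.1 hz).2
    simp only [supAbs] at hz
    simp only [Finset.mem_union, Finset.mem_product, Finset.mem_insert, Finset.mem_singleton,
      Finset.mem_Icc]
    omega
  refine (Finset.card_le_card hsub).trans ((Finset.card_union_le _ _).trans ?_)
  rw [Finset.card_product, Finset.card_product, Int.card_Icc]
  have h2 : ({(m : ℤ), -(m : ℤ)} : Finset ℤ).card ≤ 2 := Finset.card_le_two
  have h3 : ((m : ℤ) + 1 - -(m : ℤ)).toNat ≤ 3 * m := by omega
  have := Nat.mul_le_mul h2 h3
  have := Nat.mul_le_mul h3 h2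
  omega

theorem sum_inv_supAbs_sq_le (S : ℕ) :
    ∑ z ∈ punctured S, (1 : ℝ) / (supAbs z : ℝ) ^ 2 ≤ 12 * (1 + Real.log S) := by
  have hmaps : ∀ z ∈ punctured S, supAbs z ∈ Finset.Icc 1 S := fun z hz => by
    have := mem_punctured.1 hz
    exact Finset.mem_Icc.2 ⟨supAbs_pos this.1, this.2⟩
  rw [← Finset.sum_fiberwise_of_maps_to hmaps]
  calc _ ≤ ∑ m ∈ Finset.Icc 1 S, 12 * ((m : ℝ))⁻¹ := by
        refine Finset.sum_le_sum fun m hm => ?_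
        have hm1 : 1 ≤ m := (Finset.mem_Icc.1 hm).1
        have hm0 : (0 : ℝ) < m := by exact_mod_cast hm1
        have hc : (((punctured S).filter (fun z => supAbs z = m)).card : ℝ) ≤ 12 * m := by
          exact_mod_cast card_supAbs_eq_le S m (by omega)
        calc _ = ∑ z ∈ (punctured S).filter (fun z => supAbs z = m), (1 : ℝ) / (m : ℝ) ^ 2 :=
              Finset.sum_congr rfl fun z hz => by rw [(Finset.mem_filter.1 hz).2]
          _ = ((punctured S).filter (fun z => supAbs z = m)).card * ((1 : ℝ) / (m : ℝ) ^ 2) := by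
              rw [Finset.sum_const, nsmul_eq_mul]
          _ ≤ 12 * m * ((1 : ℝ) / (m : ℝ) ^ 2) := by gcongr
          _ = _ := by field_simp
    _ = 12 * ((harmonic S : ℚ) : ℝ) := by
        rw [← Finset.mul_sum, harmonic_eq_sum_Icc]; push_cast; rfl
    _ ≤ _ := by
        gcongr
        exact harmonic_le_one_add_log S

theorem card_le_one_add_sum {S : ℕ} (G : Finset (ℕ × ℕ)) (hG : ∀ p ∈ G, p.1 ≤ S ∧ p.2 ≤ S)
    (Δ : Finset (ℤ × ℤ))
    (hΔ : ∀ p ∈ G, ∀ q ∈ G, p ≠ q → ((p.1 : ℤ) - q.1, (p.2 : ℤ) - q.2) ∈ Δ) :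
    (G.card : ℝ) ≤ 1 + 4 * (S : ℝ) ^ 2 * ∑ z ∈ Δ, 1 / (supAbs z : ℝ) ^ 2 := by
  have hnn : ∀ z ∈ Δ, (0 : ℝ) ≤ 1 / (supAbs z : ℝ) ^ 2 := fun _ _ => by positivity
  rcases G.offDiag.eq_empty_or_nonempty with h | h
  · have h1 : G.card ≤ 1 := Finset.card_le_one.2 fun p hp q hq => by
      by_contra hpq
      have : (p, q) ∈ G.offDiag := Finset.mem_offDiag.2 ⟨hp, hq, hpq⟩
      simp [h] at this
    have h1' : (G.card : ℝ) ≤ 1 := by exact_mod_cast h1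
    have := Finset.sum_nonneg hnn
    nlinarith [mul_nonneg (sq_nonneg (S : ℝ)) this]
  · obtain ⟨⟨p₀, q₀⟩, h₀, hmin⟩ := Finset.exists_min_image G.offDiag
      (fun e => supAbs ((e.1.1 : ℤ) - e.2.1, (e.1.2 : ℤ) - e.2.2)) h
    set δ := supAbs ((p₀.1 : ℤ) - q₀.1, (p₀.2 : ℤ) - q₀.2) with hδ
    obtain ⟨hp₀, hq₀, hne⟩ := Finset.mem_offDiag.1 h₀
    have hδ0 : 0 < δ := supAbs_pos fun h0 => hne <| by
      have h1 := congrArg Prod.fst h0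
      have h2 := congrArg Prod.snd h0
      simp only [Prod.fst_zero, Prod.snd_zero] at h1 h2
      exact show p₀ = q₀ from Prod.ext (by omega) (by omega)
    have hδS : δ ≤ S := by
      have := hG p₀ hp₀
      have := hG q₀ hq₀
      simp only [hδ, supAbs]
      omega
    have hcard : G.card ≤ (S / δ + 1) * (S / δ + 1) := by
      calc G.card ≤ (Finset.range (S / δ + 1) ×ˢ Finset.range (S / δ + 1)).card := by
            refine Finset.card_le_card_of_injOn (fun p => (p.1 / δ, p.2 / δ)) ?_ ?_
            · intro p hp
              have := hG p hp
              simp only [Finset.coe_product, Set.mem_prod, Finset.coe_range, Set.mem_Iio,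
                Nat.lt_succ_iff]
              exact ⟨Nat.div_le_div_right this.1, Nat.div_le_div_right this.2⟩
            · intro p hp q hq hpq
              by_contra hne'
              have hm := hmin (p, q) (Finset.mem_offDiag.2 ⟨hp, hq, hne'⟩)
              simp only [Prod.mk.injEq] at hpq
              have a₁ := Nat.div_add_mod p.1 δ
              have a₂ := Nat.div_add_mod p.2 δ
              have a₃ := Nat.div_add_mod q.1 δ
              have a₄ := Nat.div_add_mod q.2 δ
              rw [← hpq.1] at a₃
              rw [← hpq.2] at a₄
              have b₁ := Nat.mod_lt p.1 hδ0
              have b₂ := Nat.mod_lt p.2 hδ0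
              have b₃ := Nat.mod_lt q.1 hδ0
              have b₄ := Nat.mod_lt q.2 hδ0
              simp only [supAbs] at hm
              generalize δ * (p.1 / δ) = c₁ at a₁ a₃
              generalize δ * (p.2 / δ) = c₂ at a₂ a₄
              omega
        _ = _ := by simp
    have hδ' : (0 : ℝ) < δ := by exact_mod_cast hδ0
    have hq : ((S / δ + 1 : ℕ) : ℝ) ≤ 2 * (S / δ) := by
      have h1 : ((S / δ : ℕ) : ℝ) ≤ (S : ℝ) / δ := Nat.cast_div_le
      have h2 : (1 : ℝ) ≤ (S : ℝ) / δ := by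
        rw [le_div_iff₀ hδ', one_mul]; exact_mod_cast hδS
      push_cast
      linarith
    have hs := Finset.single_le_sum hnn (hΔ p₀ hp₀ q₀ hq₀ hne)
    calc (G.card : ℝ) ≤ ((S / δ + 1 : ℕ) : ℝ) * ((S / δ + 1 : ℕ) : ℝ) := by exact_mod_cast hcard
      _ ≤ (2 * (S / δ)) * (2 * (S / δ)) := by gcongr
      _ = 4 * (S : ℝ) ^ 2 * (1 / (δ : ℝ) ^ 2) := by ring
      _ ≤ 4 * (S : ℝ) ^ 2 * ∑ z ∈ Δ, 1 / (supAbs z : ℝ) ^ 2 := by gcongr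
      _ ≤ _ := by linarith

/-- The ratio of `v₁` and `v₂` is the cube of a rational number. -/
def CubeRatio (v₁ v₂ : ℕ) : Prop := ∃ h s t : ℕ, v₁ = h * s ^ 3 ∧ v₂ = h * t ^ 3

theorem exists_eq_cube_of_sq_eq_cube {r m : ℕ} (h : r ^ 2 = m ^ 3) : ∃ k, r = k ^ 3 := by
  rcases Nat.eq_zero_or_pos m with rfl | hm
  · exact ⟨0, by simpa using h⟩
  · obtain ⟨k, rfl⟩ : m ∣ r := (Nat.pow_dvd_pow_iff two_ne_zero).1 (h ▸ pow_dvd_pow m (by norm_num))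
    have : k ^ 2 = m := Nat.eq_of_mul_eq_mul_left (pow_pos hm 2) (by rw [← mul_pow, h]; ring)
    exact ⟨k, by rw [← this]; ring⟩

theorem cubeRatio_of_sq_mul_cube_eq {v₁ v₂ X Y : ℕ} (hX : X ≠ 0)
    (h : v₁ ^ 2 * Y ^ 3 = v₂ ^ 2 * X ^ 3) : CubeRatio v₁ v₂ := by
  rcases Nat.eq_zero_or_pos (v₁.gcd v₂) with h0 | hpos
  · rw [Nat.gcd_eq_zero_iff] at h0
    exact ⟨0, 0, 0, by simp [h0.1], by simp [h0.2]⟩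
  obtain ⟨r₁, r₂, hr, e₁, e₂⟩ := Nat.exists_coprime v₁ v₂
  obtain ⟨x, y, hxy, f₁, f₂⟩ := Nat.exists_coprime X Y
  set c := v₁.gcd v₂
  set e := X.gcd Y
  have he : 0 < e := Nat.gcd_pos_of_pos_left _ (Nat.pos_of_ne_zero hX)
  have key : r₁ ^ 2 * y ^ 3 = r₂ ^ 2 * x ^ 3 := by
    apply Nat.eq_of_mul_eq_mul_left (show 0 < c ^ 2 * e ^ 3 by positivity)
    rw [e₁, e₂, f₁, f₂] at h
    linarith
  have k₁ : r₁ ^ 2 = x ^ 3 := Nat.dvd_antisymm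
    ((hr.pow 2 2).dvd_of_dvd_mul_left (key ▸ dvd_mul_right _ _))
    ((hxy.pow 3 3).dvd_of_dvd_mul_right (key ▸ dvd_mul_left _ _))
  have k₂ : r₂ ^ 2 = y ^ 3 := Nat.dvd_antisymm
    ((hr.symm.pow 2 2).dvd_of_dvd_mul_left (key ▸ dvd_mul_right _ _))
    ((hxy.symm.pow 3 3).dvd_of_dvd_mul_right (key ▸ dvd_mul_left _ _))
  obtain ⟨s, hs⟩ := exists_eq_cube_of_sq_eq_cube k₁
  obtain ⟨t, ht⟩ := exists_eq_cube_of_sq_eq_cube k₂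
  exact ⟨c, s, t, by rw [← hs, mul_comm]; exact e₁, by rw [← ht, mul_comm]; exact e₂⟩

theorem sq_mul_cube_sub_ne_zero {v₁ v₂ : ℕ} (h₁ : v₁ ≠ 0) (hv : ¬ CubeRatio v₁ v₂)
    {x y : ℤ} (hxy : (x, y) ≠ 0) : (v₁ : ℤ) ^ 2 * y ^ 3 - (v₂ : ℤ) ^ 2 * x ^ 3 ≠ 0 := by
  intro h
  have heq := sub_eq_zero.1 h
  have habs : v₁ ^ 2 * y.natAbs ^ 3 = v₂ ^ 2 * x.natAbs ^ 3 := by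
    simpa [Int.natAbs_mul, Int.natAbs_pow] using congrArg Int.natAbs heq
  by_cases hx : x = 0
  · subst hx
    have hy : y = 0 := by simpa [h₁] using habs
    exact hxy (by rw [hy]; rfl)
  · exact hv (cubeRatio_of_sq_mul_cube_eq (Int.natAbs_ne_zero.2 hx) habs)

open scoped Classical in
theorem card_cubeRatio_le (V : ℕ) :
    (((Finset.Icc 1 V ×ˢ Finset.Icc 1 V).filter (fun v => CubeRatio v.1 v.2)).card : ℝ) ≤
      12 * V * (1 + Real.log V) := by
  have hsub : (Finset.Icc 1 V ×ˢ Finset.Icc 1 V).filter (fun v => CubeRatio v.1 v.2) ⊆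
      (punctured V).biUnion fun z => (Finset.Icc 1 (V / supAbs z ^ 3)).image
        fun h => (h * z.1.natAbs ^ 3, h * z.2.natAbs ^ 3) := by
    rintro ⟨v₁, v₂⟩ hv
    simp only [Finset.mem_filter, Finset.mem_product, Finset.mem_Icc] at hv
    obtain ⟨⟨⟨p₁, l₁⟩, ⟨p₂, l₂⟩⟩, h, s, t, rfl, rfl⟩ := hv
    have hh : 0 < h := Nat.pos_of_mul_pos_right p₁
    have hs : 0 < s := by
      rcases Nat.eq_zero_or_pos s with rfl | hs
      · simp at p₁
      · exact hs
    have hmax : h * max s t ^ 3 ≤ V := by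
      rcases le_total s t with hst | hst
      · rwa [max_eq_right hst]
      · rwa [max_eq_left hst]
    have hmaxV : max s t ≤ V := by
      calc max s t ≤ max s t ^ 3 := Nat.le_self_pow (by norm_num) _
        _ ≤ h * max s t ^ 3 := Nat.le_mul_of_pos_left _ hh
        _ ≤ V := hmax
    simp only [Finset.mem_biUnion, Finset.mem_image, Finset.mem_Icc]
    refine ⟨((s : ℤ), (t : ℤ)), mem_punctured.2 ⟨fun h0 => ?_, by simpa [supAbs] using hmaxV⟩,
      h, ⟨hh, ?_⟩, by simp⟩
    · have := congrArg Prod.fst h0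
      simp only [Prod.fst_zero] at this
      omega
    · rw [Nat.le_div_iff_mul_le (pow_pos (by simp [supAbs, hs]) 3)]
      simpa [supAbs] using hmax
  calc _ ≤ ((∑ z ∈ punctured V, V / supAbs z ^ 3 : ℕ) : ℝ) := by
        norm_cast
        refine (Finset.card_le_card hsub).trans (Finset.card_biUnion_le.trans ?_)
        refine Finset.sum_le_sum fun z _ => Finset.card_image_le.trans ?_
        simp
    _ ≤ ∑ z ∈ punctured V, (V : ℝ) * (1 / (supAbs z : ℝ) ^ 2) := by
        push_cast
        refine Finset.sum_le_sum fun z hz => ?_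
        have h1 : (1 : ℝ) ≤ supAbs z := by exact_mod_cast supAbs_pos (mem_punctured.1 hz).1
        calc ((V / supAbs z ^ 3 : ℕ) : ℝ) ≤ (V : ℝ) / ((supAbs z ^ 3 : ℕ) : ℝ) := Nat.cast_div_le
          _ ≤ (V : ℝ) / (supAbs z : ℝ) ^ 2 := by
              push_cast
              gcongr
              norm_num
          _ = _ := by ring
    _ ≤ V * (12 * (1 + Real.log V)) := by
        rw [← Finset.mul_sum]
        gcongr
        exact sum_inv_supAbs_sq_le V
    _ = _ := by ring

theorem card_le_two_mul_card_divisors {n : ℤ} (hn : n ≠ 0) (F : Finset ℤ)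
    (hF : ∀ a ∈ F, a ∣ n) : F.card ≤ 2 * n.natAbs.divisors.card := by
  have hsub : F ⊆ n.natAbs.divisors.image (fun k : ℕ => (k : ℤ)) ∪
      n.natAbs.divisors.image (fun k : ℕ => -(k : ℤ)) := by
    intro a ha
    have hd : a.natAbs ∈ n.natAbs.divisors :=
      Nat.mem_divisors.2 ⟨Int.natAbs_dvd_natAbs.2 (hF a ha), Int.natAbs_ne_zero.2 hn⟩
    rw [Finset.mem_union, Finset.mem_image, Finset.mem_image]
    rcases Int.natAbs_eq a with h | h
    · exact Or.inl ⟨_, hd, h.symm⟩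
    · exact Or.inr ⟨_, hd, h.symm⟩
  calc F.card ≤ _ := Finset.card_le_card hsub
    _ ≤ _ := Finset.card_union_le _ _
    _ ≤ n.natAbs.divisors.card + n.natAbs.divisors.card :=
        Nat.add_le_add Finset.card_image_le Finset.card_image_le
    _ = _ := by ring

theorem card_pairs_dvd_le {S V D : ℕ}
    (hD : ∀ n : ℕ, n ≠ 0 → n ≤ 8 * S ^ 3 * V ^ 2 → n.divisors.card ≤ D) {y : ℤ} (hy : y ≠ 0)
    (hyS : y.natAbs ≤ S) (Q : Finset (ℕ × ℕ))
    (hQ : ∀ q ∈ Q, q.1 ∈ Finset.Icc 1 V ∧ (q.2 : ℤ) ∣ 4 * q.1 * y) : Q.card ≤ D * V := by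
  have h := Finset.card_le_mul_card_image_of_maps_to (f := Prod.fst) (s := Q)
    (t := Finset.Icc 1 V) (fun q hq => (hQ q hq).1) D fun v hv => ?_
  · simpa using h
  obtain ⟨hv1, hvV⟩ := Finset.mem_Icc.1 hv
  have hy0 : 0 < y.natAbs := Int.natAbs_pos.2 hy
  have hS : 0 < S := hy0.trans_le hyS
  refine le_trans ?_ (hD (4 * v * y.natAbs) (by positivity) ?_)
  · refine Finset.card_le_card_of_injOn Prod.snd ?_ ?_
    · rintro ⟨q₁, q₂⟩ hq
      obtain ⟨hq', rfl⟩ := Finset.mem_filter.1 hq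
      have := Int.natAbs_dvd_natAbs.2 (hQ _ hq').2
      simp only [Int.natAbs_mul, Int.natAbs_natCast] at this
      exact Nat.mem_divisors.2 ⟨this, by positivity⟩
    · rintro ⟨q₁, q₂⟩ hq ⟨r₁, r₂⟩ hr h
      have hq := (Finset.mem_filter.1 hq).2
      have hr := (Finset.mem_filter.1 hr).2
      simp only at hq hr h
      rw [hq, hr, h]
  · calc 4 * v * y.natAbs ≤ 4 * V * S := by gcongr
      _ ≤ 8 * V ^ 2 * S ^ 3 := by
          gcongr
          · norm_num
          · exact Nat.le_self_pow two_ne_zero _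
          · exact Nat.le_self_pow three_ne_zero _
      _ = _ := by ring

theorem card_isDiff_le {S V D : ℕ}
    (hD : ∀ n : ℕ, n ≠ 0 → n ≤ 8 * S ^ 3 * V ^ 2 → n.divisors.card ≤ D)
    {z : ℤ × ℤ} (hz : z ∈ punctured S) (E : Finset ((ℕ × ℕ) × ℤ))
    (hE : ∀ e ∈ E, e.1 ∈ Finset.Icc 1 V ×ˢ Finset.Icc 1 V ∧ ¬ CubeRatio e.1.1 e.1.2 ∧
      IsDiff e.1.1 e.1.2 e.2 z.1 z.2) : E.card ≤ 2 * D ^ 2 * V := by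
  obtain ⟨x, y⟩ := z
  obtain ⟨hz0, hzS⟩ := mem_punctured.1 hz
  simp only [supAbs, max_le_iff] at hzS
  have hQ : (E.image Prod.fst).card ≤ D * V := by
    by_cases hy : y = 0
    · have hx : x ≠ 0 := fun hx => hz0 (by rw [hx, hy]; rfl)
      rw [← Finset.card_image_of_injective _ Prod.swap_injective]
      refine card_pairs_dvd_le hD hx hzS.1 _ fun q hq => ?_
      simp only [Finset.mem_image] at hq
      obtain ⟨_, ⟨e, he, rfl⟩, rfl⟩ := hq
      obtain ⟨h₁, -, h₂, -⟩ := hE e he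
      exact ⟨(Finset.mem_product.1 h₁).2, h₂⟩
    · refine card_pairs_dvd_le hD hy hzS.2 _ fun q hq => ?_
      simp only [Finset.mem_image] at hq
      obtain ⟨e, he, rfl⟩ := hq
      obtain ⟨h₁, -, -, h₂, -⟩ := hE e he
      exact ⟨(Finset.mem_product.1 h₁).1, h₂⟩
  have h := Finset.card_le_mul_card_image_of_maps_to (f := Prod.fst) (s := E)
    (t := E.image Prod.fst) (fun e he => Finset.mem_image_of_mem _ he) (2 * D) fun v hv => ?_
  · calc E.card ≤ _ := h
      _ ≤ 2 * D * (D * V) := by gcongr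
      _ = _ := by ring
  obtain ⟨e, he, rfl⟩ := Finset.mem_image.1 hv
  obtain ⟨⟨v₁, v₂⟩, a⟩ := e
  obtain ⟨hv, hc, -⟩ := hE _ he
  simp only [Finset.mem_product, Finset.mem_Icc] at hv
  have hn := sq_mul_cube_sub_ne_zero (show v₁ ≠ 0 by omega) hc hz0
  set n : ℤ := 4 * ((v₁ : ℤ) ^ 2 * y ^ 3 - (v₂ : ℤ) ^ 2 * x ^ 3) with hn_def
  have hn0 : n ≠ 0 := by simpa [hn_def] using hn
  have hnle : n.natAbs ≤ 8 * S ^ 3 * V ^ 2 := by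
    have h1 : ((v₁ : ℤ) ^ 2 * y ^ 3).natAbs ≤ V ^ 2 * S ^ 3 := by
      rw [Int.natAbs_mul, Int.natAbs_pow, Int.natAbs_pow, Int.natAbs_natCast]
      exact Nat.mul_le_mul (Nat.pow_le_pow_left hv.1.2 2) (Nat.pow_le_pow_left hzS.2 3)
    have h2 : ((v₂ : ℤ) ^ 2 * x ^ 3).natAbs ≤ V ^ 2 * S ^ 3 := by
      rw [Int.natAbs_mul, Int.natAbs_pow, Int.natAbs_pow, Int.natAbs_natCast]
      exact Nat.mul_le_mul (Nat.pow_le_pow_left hv.2.2 2) (Nat.pow_le_pow_left hzS.1 3)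
    rw [hn_def, mul_assoc 8, mul_comm (S ^ 3)]
    omega
  calc _ = ((E.filter fun e => e.1 = (v₁, v₂)).image Prod.snd).card := by
        refine (Finset.card_image_of_injOn ?_).symm
        rintro ⟨q₁, q₂⟩ hq ⟨r₁, r₂⟩ hr h
        have hq := (Finset.mem_filter.1 hq).2
        have hr := (Finset.mem_filter.1 hr).2
        simp only at hq hr h
        rw [hq, hr, h]
    _ ≤ 2 * n.natAbs.divisors.card := by
        refine card_le_two_mul_card_divisors hn0 _ fun a ha => ?_
        simp only [Finset.mem_image, Finset.mem_filter] at ha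
        obtain ⟨⟨_, _⟩, ⟨he, rfl⟩, rfl⟩ := ha
        exact (hE _ he).2.2.2.2
    _ ≤ 2 * D := by gcongr; exact hD _ (Int.natAbs_ne_zero.2 hn0) hnle

theorem card_repPairs_three_le {S U V D : ℕ}
    (hD : ∀ n : ℕ, n ≠ 0 → n ≤ 8 * S ^ 3 * V ^ 2 + U * V → n.divisors.card ≤ D)
    (P : Finset ((ℕ × ℕ × ℕ) × (ℕ × ℕ × ℕ)))
    (hP : ∀ p ∈ P, IsRepPair 3 S U V p ∧ p.1.1.Coprime p.2.1 ∧ ¬ CubeRatio p.1.2.2 p.2.2.2) :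
    (P.card : ℝ) ≤ (D : ℝ) ^ 6 * ((V : ℝ) ^ 2 * (2 * (U * V) + 1) +
      4 * (S : ℝ) ^ 2 * (2 * (D : ℝ) ^ 2 * V * (12 * (1 + Real.log S)))) := by
  classical
  set f : (ℕ × ℕ × ℕ) × (ℕ × ℕ × ℕ) → (ℕ × ℕ) × ℤ := fun p =>
    ((p.1.2.2, p.2.2.2), (p.1.2.1 : ℤ) * p.2.2.2 - p.2.2.1 * p.1.2.2) with hf
  set E := P.image f with hE
  have hEmem : ∀ e ∈ E, e.1 ∈ Finset.Icc 1 V ×ˢ Finset.Icc 1 V ∧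
      e.2 ∈ Finset.Icc (-((U * V : ℕ) : ℤ)) ((U * V : ℕ) : ℤ) ∧ e.2 ≠ 0 ∧
      ¬ CubeRatio e.1.1 e.1.2 := by
    intro e he
    obtain ⟨p, hp, rfl⟩ := Finset.mem_image.1 he
    obtain ⟨⟨hne, d, h₁, h₂⟩, hc, hr⟩ := hP p hp
    have hmul := h₁.mul_eq h₂
    have h0 := IsRep.sub_ne_zero three_ne_zero h₁ h₂ hne
    rw [← hmul] at h0
    have b₁ : p.1.2.1 * p.2.2.2 ≤ U * V := Nat.mul_le_mul h₁.u_le h₂.v_le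
    have b₂ : p.2.2.1 * p.1.2.2 ≤ U * V := Nat.mul_le_mul h₂.u_le h₁.v_le
    refine ⟨Finset.mem_product.2 ⟨Finset.mem_Icc.2 ⟨h₁.v_pos, h₁.v_le⟩,
      Finset.mem_Icc.2 ⟨h₂.v_pos, h₂.v_le⟩⟩, Finset.mem_Icc.2 ?_, left_ne_zero_of_mul h0, hr⟩
    simp only [hf]
    zify at b₁ b₂
    have := mul_nonneg (Int.natCast_nonneg p.1.2.1) (Int.natCast_nonneg p.2.2.2)
    have := mul_nonneg (Int.natCast_nonneg p.2.2.1) (Int.natCast_nonneg p.1.2.2)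
    push_cast
    constructor <;> linarith
  have hEcard : (E.card : ℝ) ≤ (V : ℝ) ^ 2 * (2 * (U * V) + 1) := by
    have hsub : E ⊆ (Finset.Icc 1 V ×ˢ Finset.Icc 1 V) ×ˢ
        Finset.Icc (-((U * V : ℕ) : ℤ)) ((U * V : ℕ) : ℤ) := fun e he =>
      Finset.mem_product.2 ⟨(hEmem e he).1, (hEmem e he).2.1⟩
    have h := Finset.card_le_card hsub
    rw [Finset.card_product, Finset.card_product, Nat.card_Icc, Int.card_Icc,
      Nat.add_sub_cancel] at h
    have h2 : (((U * V : ℕ) : ℤ) + 1 - -((U * V : ℕ) : ℤ)).toNat = 2 * (U * V) + 1 := by omega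
    rw [h2] at h
    calc (E.card : ℝ) ≤ ((V * V * (2 * (U * V) + 1) : ℕ) : ℝ) := by exact_mod_cast h
      _ = _ := by push_cast; ring
  have hfib : ∀ e ∈ E, ((P.filter fun p => f p = e).card : ℝ) ≤
      (D : ℝ) ^ 6 * (1 + 4 * (S : ℝ) ^ 2 * ∑ z ∈ punctured S with
        IsDiff e.1.1 e.1.2 e.2 z.1 z.2, 1 / (supAbs z : ℝ) ^ 2) := by
    rintro ⟨⟨v₁, v₂⟩, a⟩ he
    have ha : a ≠ 0 := (hEmem _ he).2.2.1
    set Q := P.filter fun p => f p = ((v₁, v₂), a) with hQ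
    set F := Q.image fun p => (p.1.1, p.2.1) with hF
    have hQF : Q.card = F.card := by
      refine (Finset.card_image_of_injOn ?_).symm
      rintro ⟨⟨w₁, u₁, x₁⟩, w₂, u₂, x₂⟩ hp ⟨⟨w₁', u₁', x₁'⟩, w₂', u₂', x₂'⟩ hq hw
      obtain ⟨hp', hpe⟩ := Finset.mem_filter.1 hp
      obtain ⟨hq', hqe⟩ := Finset.mem_filter.1 hq
      simp only [hf, Prod.mk.injEq] at hpe hqe hw
      obtain ⟨⟨rfl, rfl⟩, hpa⟩ := hpe
      obtain ⟨⟨rfl, rfl⟩, hqa⟩ := hqe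
      obtain ⟨rfl, rfl⟩ := hw
      obtain ⟨⟨-, d, h₁, h₂⟩, -⟩ := hP _ hp'
      obtain ⟨⟨-, d', h₁', h₂'⟩, -⟩ := hP _ hq'
      have e₁ := h₁.mul_eq h₂
      have e₂ := h₁'.mul_eq h₂'
      have p₁ := h₁.v_pos
      have p₂ := h₂.v_pos
      simp only at e₁ e₂ p₁ p₂
      rw [← e₂, hpa, hqa] at e₁
      have hb := mul_left_cancel₀ ha e₁
      have k₁ : (u₁ : ℤ) = u₁' :=
        mul_right_cancel₀ (b := (x₂' : ℤ)) (by exact_mod_cast p₂.ne') (by linarith)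
      have k₂ : (u₂ : ℤ) = u₂' :=
        mul_right_cancel₀ (b := (x₁' : ℤ)) (by exact_mod_cast p₁.ne') (by linarith)
      rw [Nat.cast_inj] at k₁ k₂
      rw [k₁, k₂]
    have hFmem : ∀ p ∈ F, p.1.Coprime p.2 ∧ ∃ d u₁ u₂ : ℕ, IsRep 3 S U V d (p.1, u₁, v₁) ∧
        IsRep 3 S U V d (p.2, u₂, v₂) ∧ (u₁ : ℤ) * v₂ - u₂ * v₁ = a := by
      intro p hp
      obtain ⟨⟨⟨w₁, u₁, x₁⟩, w₂, u₂, x₂⟩, hq, rfl⟩ := Finset.mem_image.1 hp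
      obtain ⟨hq', hqe⟩ := Finset.mem_filter.1 hq
      simp only [hf, Prod.mk.injEq] at hqe
      obtain ⟨⟨rfl, rfl⟩, rfl⟩ := hqe
      obtain ⟨⟨-, d, h₁, h₂⟩, hc, -⟩ := hP _ hq'
      exact ⟨hc, d, u₁, u₂, h₁, h₂, rfl⟩
    have hbox : ∀ p ∈ F, p.1 ≤ S ∧ p.2 ≤ S := fun p hp => by
      obtain ⟨-, d, u₁, u₂, h₁, h₂, -⟩ := hFmem p hp
      exact ⟨h₁.w_le, h₂.w_le⟩
    set R : ℝ := 1 + 4 * (S : ℝ) ^ 2 * ∑ z ∈ punctured S with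
        IsDiff v₁ v₂ a z.1 z.2, 1 / (supAbs z : ℝ) ^ 2 with hR
    have hR0 : 0 ≤ R := by positivity
    have hcard := card_fiber_le (M := ⌊R⌋₊) ha hD F hFmem fun G hG hdiff =>
      Nat.le_floor <| card_le_one_add_sum G (fun p hp => hbox p (hG hp)) _ fun p hp q hq hpq => by
        have hp' := hbox p (hG hp)
        have hq' := hbox q (hG hq)
        refine Finset.mem_filter.2 ⟨mem_punctured.2 ⟨fun h0 => hpq ?_, ?_⟩, hdiff p hp q hq⟩
        · have h1 := congrArg Prod.fst h0
          have h2 := congrArg Prod.snd h0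
          simp only [Prod.fst_zero, Prod.snd_zero] at h1 h2
          exact Prod.ext (by omega) (by omega)
        · simp only [supAbs]
          omega
    rw [hQF]
    calc (F.card : ℝ) ≤ ((⌊R⌋₊ * D ^ 6 : ℕ) : ℝ) := by exact_mod_cast hcard
      _ = (⌊R⌋₊ : ℝ) * (D : ℝ) ^ 6 := by push_cast; ring
      _ ≤ R * (D : ℝ) ^ 6 := by gcongr; exact Nat.floor_le hR0
      _ = _ := by ring
  calc (P.card : ℝ) = ∑ e ∈ E, ((P.filter fun p => f p = e).card : ℝ) := by
        rw [Finset.card_eq_sum_card_image f P]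
        push_cast
        rfl
    _ ≤ ∑ e ∈ E, (D : ℝ) ^ 6 * (1 + 4 * (S : ℝ) ^ 2 * ∑ z ∈ punctured S with
        IsDiff e.1.1 e.1.2 e.2 z.1 z.2, 1 / (supAbs z : ℝ) ^ 2) := Finset.sum_le_sum hfib
    _ = (D : ℝ) ^ 6 * (E.card + 4 * (S : ℝ) ^ 2 * ∑ z ∈ punctured S,
          ((E.filter fun e => IsDiff e.1.1 e.1.2 e.2 z.1 z.2).card : ℝ) *
            (1 / (supAbs z : ℝ) ^ 2)) := by
        rw [← Finset.mul_sum, Finset.sum_add_distrib, ← Finset.mul_sum, Finset.sum_const,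
          nsmul_one]
        congr 3
        simp only [Finset.sum_filter]
        rw [Finset.sum_comm]
        refine Finset.sum_congr rfl fun z _ => ?_
        rw [← Finset.sum_filter, Finset.sum_const, nsmul_eq_mul]
    _ ≤ (D : ℝ) ^ 6 * (E.card + 4 * (S : ℝ) ^ 2 * ∑ z ∈ punctured S,
          (2 * (D : ℝ) ^ 2 * V) * (1 / (supAbs z : ℝ) ^ 2)) := by
        gcongr with z hz
        have := card_isDiff_le (V := V) (fun n h0 hn => hD n h0 (by omega)) hz
          (E.filter fun e => IsDiff e.1.1 e.1.2 e.2 z.1 z.2) fun e he => by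
            obtain ⟨he, hd⟩ := Finset.mem_filter.1 he
            exact ⟨(hEmem e he).1, (hEmem e he).2.2.2, hd⟩
        exact_mod_cast this
    _ ≤ _ := by
        rw [← Finset.mul_sum]
        gcongr
        exact sum_inv_supAbs_sq_le S

theorem exists_card_divisors_le_of_le_pow (A : ℕ) (K₀ : ℝ) {ε : ℝ} (hε : 0 < ε) :
    ∃ K : ℝ, 1 ≤ K ∧ ∀ X : ℝ, 1 ≤ X → ∀ n : ℕ, n ≠ 0 → (n : ℝ) ≤ K₀ * X ^ A →
      (n.divisors.card : ℝ) ≤ K * X ^ ε ∧ 1 + Real.log n ≤ K * X ^ ε := by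
  set η : ℝ := ε / (A + 1) with hη_def
  have hA : (0 : ℝ) < A + 1 := by positivity
  have hη : 0 < η := by positivity
  obtain ⟨C, hC1, hC⟩ := exists_card_divisors_le_rpow hη
  set M : ℝ := max C (1 + 1 / η)
  have hM1 : 1 ≤ M := hC1.trans (le_max_left _ _)
  have hK₁ : (1 : ℝ) ≤ (max K₀ 1) ^ η := Real.one_le_rpow (le_max_right _ _) hη.le
  refine ⟨M * (max K₀ 1) ^ η, one_le_mul_of_one_le_of_one_le hM1 hK₁, fun X hX n hn hnX => ?_⟩
  have hn1 : (1 : ℝ) ≤ n := by exact_mod_cast Nat.one_le_iff_ne_zero.2 hn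
  have hnη1 : (1 : ℝ) ≤ (n : ℝ) ^ η := Real.one_le_rpow hn1 hη.le
  have hX0 : (0 : ℝ) ≤ X := by linarith
  have hnη : (n : ℝ) ^ η ≤ (max K₀ 1) ^ η * X ^ ε := by
    calc (n : ℝ) ^ η ≤ (max K₀ 1 * X ^ A) ^ η := by
          refine Real.rpow_le_rpow (by positivity) (hnX.trans ?_) hη.le
          gcongr
          exact le_max_left _ _
      _ = (max K₀ 1) ^ η * X ^ (A * η) := by
          rw [Real.mul_rpow (by positivity) (by positivity), ← Real.rpow_natCast,
            ← Real.rpow_mul hX0]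
      _ ≤ (max K₀ 1) ^ η * X ^ ε := by
          gcongr
          rw [hη_def, mul_div_assoc', div_le_iff₀ hA]
          nlinarith
  have hMn : M * (n : ℝ) ^ η ≤ M * (max K₀ 1) ^ η * X ^ ε := by
    rw [mul_assoc]
    gcongr
  refine ⟨le_trans ((hC n hn).trans ?_) hMn, le_trans ?_ hMn⟩
  · gcongr
    exact le_max_left _ _
  · calc 1 + Real.log n ≤ (n : ℝ) ^ η + (n : ℝ) ^ η / η :=
          add_le_add hnη1 (Real.log_le_rpow_div (by positivity) hη)
      _ = (1 + 1 / η) * (n : ℝ) ^ η := by ring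
      _ ≤ _ := by
          gcongr
          exact le_max_right _ _

/-- `w` is a product of two distinct primes of `[Z, 2Z)`. -/
def IsPrimeProduct (Z : ℝ) (w : ℕ) : Prop :=
  ∃ p₁ p₂ : ℕ, p₁.Prime ∧ p₂.Prime ∧ p₁ ≠ p₂ ∧
    Z ≤ p₁ ∧ (p₁ : ℝ) < 2 * Z ∧ Z ≤ p₂ ∧ (p₂ : ℝ) < 2 * Z ∧ w = p₁ * p₂

theorem IsPrimeProduct.exists_eq_mul {Z : ℝ} {w q : ℕ} (hw : IsPrimeProduct Z w) (hq : q.Prime)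
    (hqw : q ∣ w) : ∃ p : ℕ, w = q * p ∧ (q : ℝ) < 2 * Z ∧ (p : ℝ) < 2 * Z := by
  obtain ⟨p₁, p₂, h₁, h₂, -, -, l₁, -, l₂, rfl⟩ := hw
  rcases (hq.dvd_mul).1 hqw with h | h
  · rw [(Nat.prime_dvd_prime_iff_eq hq h₁).1 h]
    exact ⟨p₂, rfl, l₁, l₂⟩
  · rw [(Nat.prime_dvd_prime_iff_eq hq h₂).1 h]
    exact ⟨p₁, mul_comm _ _, l₂, l₁⟩

theorem card_not_coprime_le {Z : ℝ} (hZ : 1 ≤ Z) (T : Finset (ℕ × ℕ))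
    (hT : ∀ p ∈ T, IsPrimeProduct Z p.1 ∧ IsPrimeProduct Z p.2 ∧ ¬ p.1.Coprime p.2) :
    (T.card : ℝ) ≤ 27 * Z ^ 3 := by
  have hsub : T ⊆ (Finset.range ⌈2 * Z⌉₊ ×ˢ Finset.range ⌈2 * Z⌉₊ ×ˢ Finset.range ⌈2 * Z⌉₊).image
      fun e => (e.1 * e.2.1, e.1 * e.2.2) := by
    rintro ⟨w₁, w₂⟩ hp
    obtain ⟨h₁, h₂, hc⟩ := hT _ hp
    obtain ⟨q, hq, d₁, d₂⟩ := Nat.Prime.not_coprime_iff_dvd.1 hc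
    obtain ⟨p, rfl, lq, lp⟩ := h₁.exists_eq_mul hq d₁
    obtain ⟨p', rfl, -, lp'⟩ := h₂.exists_eq_mul hq d₂
    exact Finset.mem_image.2 ⟨(q, p, p'), by simp [Nat.lt_ceil, lq, lp, lp'], rfl⟩
  have h := (Finset.card_le_card hsub).trans Finset.card_image_le
  simp only [Finset.card_product, Finset.card_range] at h
  have hN : (⌈2 * Z⌉₊ : ℝ) ≤ 3 * Z := by
    have := Nat.ceil_lt_add_one (show 0 ≤ 2 * Z by linarith)
    linarith
  calc (T.card : ℝ) ≤ ((⌈2 * Z⌉₊ * (⌈2 * Z⌉₊ * ⌈2 * Z⌉₊) : ℕ) : ℝ) := by exact_mod_cast h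
    _ = (⌈2 * Z⌉₊ : ℝ) ^ 3 := by push_cast; ring
    _ ≤ (3 * Z) ^ 3 := by gcongr
    _ = _ := by ring

theorem card_primeProductPairs_three_le {Z : ℝ} (hZ : 1 ≤ Z) {S U V D : ℕ}
    (hD : ∀ n : ℕ, n ≠ 0 → n ≤ 8 * S ^ 3 * V ^ 2 + U * V → n.divisors.card ≤ D)
    (P : Finset ((ℕ × ℕ × ℕ) × (ℕ × ℕ × ℕ)))
    (hP : ∀ p ∈ P, IsRepPair 3 S U V p ∧ IsPrimeProduct Z p.1.1 ∧ IsPrimeProduct Z p.2.1) :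
    (P.card : ℝ) ≤ D * ((S : ℝ) ^ 2 * (12 * V * (1 + Real.log V))) +
      D * (27 * Z ^ 3 * (V : ℝ) ^ 2) +
      (D : ℝ) ^ 6 * ((V : ℝ) ^ 2 * (2 * (U * V) + 1) +
        4 * (S : ℝ) ^ 2 * (2 * (D : ℝ) ^ 2 * V * (12 * (1 + Real.log S)))) := by
  classical
  have hbox : ∀ p ∈ P, (p.1.2.2, p.2.2.2) ∈ Finset.Icc 1 V ×ˢ Finset.Icc 1 V ∧
      (p.1.1, p.2.1) ∈ Finset.Icc 1 S ×ˢ Finset.Icc 1 S := fun p hp => by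
    obtain ⟨⟨-, d, h₁, h₂⟩, -⟩ := hP p hp
    simp only [Finset.mem_product, Finset.mem_Icc]
    exact ⟨⟨⟨h₁.v_pos, h₁.v_le⟩, h₂.v_pos, h₂.v_le⟩, ⟨h₁.w_pos, h₁.w_le⟩, h₂.w_pos, h₂.w_le⟩
  set P₁ := P.filter fun p => CubeRatio p.1.2.2 p.2.2.2 with hP₁
  set P₂ := P.filter fun p => ¬ p.1.1.Coprime p.2.1 with hP₂
  set P₃ := P.filter fun p => p.1.1.Coprime p.2.1 ∧ ¬ CubeRatio p.1.2.2 p.2.2.2 with hP₃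
  have hcover : P ⊆ P₁ ∪ P₂ ∪ P₃ := fun p hp => by
    simp only [hP₁, hP₂, hP₃, Finset.mem_union, Finset.mem_filter, hp, true_and]
    tauto
  have h₁ : (P₁.card : ℝ) ≤ D * ((S : ℝ) ^ 2 * (12 * V * (1 + Real.log V))) := by
    have h := card_repPairs_le three_ne_zero hD P₁
      (fun p hp => (hP p (Finset.filter_subset _ _ hp)).1)
      (Finset.Icc 1 S ×ˢ Finset.Icc 1 S)
      ((Finset.Icc 1 V ×ˢ Finset.Icc 1 V).filter fun v => CubeRatio v.1 v.2)
      (fun p hp => (hbox p (Finset.filter_subset _ _ hp)).2) fun p hp =>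
        Finset.mem_filter.2 ⟨(hbox p (Finset.filter_subset _ _ hp)).1, (Finset.mem_filter.1 hp).2⟩
    rw [Finset.card_product, Nat.card_Icc, Nat.add_sub_cancel] at h
    have h' : (P₁.card : ℝ) ≤ D * (S * S * (((Finset.Icc 1 V ×ˢ Finset.Icc 1 V).filter
        fun v => CubeRatio v.1 v.2).card : ℝ)) := by exact_mod_cast h
    refine h'.trans ?_
    rw [← sq]
    gcongr
    exact card_cubeRatio_le V
  have h₂ : (P₂.card : ℝ) ≤ D * (27 * Z ^ 3 * (V : ℝ) ^ 2) := by
    have h := card_repPairs_le three_ne_zero hD P₂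
      (fun p hp => (hP p (Finset.filter_subset _ _ hp)).1)
      (P₂.image fun p => (p.1.1, p.2.1)) (Finset.Icc 1 V ×ˢ Finset.Icc 1 V)
      (fun p hp => Finset.mem_image_of_mem _ hp)
      fun p hp => (hbox p (Finset.filter_subset _ _ hp)).1
    rw [Finset.card_product, Nat.card_Icc, Nat.add_sub_cancel] at h
    have h' : (P₂.card : ℝ) ≤ D * (((P₂.image fun p => (p.1.1, p.2.1)).card : ℝ) * (V * V)) := by
      exact_mod_cast h
    refine h'.trans ?_
    rw [← sq]
    gcongr
    refine card_not_coprime_le hZ _ fun e he => ?_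
    obtain ⟨p, hp, rfl⟩ := Finset.mem_image.1 he
    obtain ⟨hp, hc⟩ := Finset.mem_filter.1 hp
    exact ⟨(hP p hp).2.1, (hP p hp).2.2, hc⟩
  have h₃ := card_repPairs_three_le hD P₃ fun p hp => by
    obtain ⟨hp, hc⟩ := Finset.mem_filter.1 hp
    exact ⟨(hP p hp).1, hc⟩
  have hsum : (P.card : ℝ) ≤ P₁.card + P₂.card + P₃.card := by
    exact_mod_cast (Finset.card_le_card hcover).trans
      ((Finset.card_union_le _ _).trans (Nat.add_le_add_right (Finset.card_union_le _ _) _))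
  linarith

open scoped Classical in
theorem Rg_eq_card (g d : ℕ) {Z : ℝ} (hZ : 1 ≤ Z) (X : ℝ) :
    ∃ A : Finset (ℕ × ℕ × ℕ), Rg g d Z X = A.card ∧ ∀ t ∈ A,
      IsRep g ⌊4 * Z ^ 2⌋₊ ⌊2 ^ (g + 1) * Z ^ g⌋₊ ⌊2 ^ (g + 1) * Z ^ g * X ^ (-(1 : ℝ) / 2)⌋₊ d t ∧
        IsPrimeProduct Z t.1 := by
  set S := ⌊4 * Z ^ 2⌋₊
  set U := ⌊2 ^ (g + 1) * Z ^ g⌋₊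
  set V := ⌊2 ^ (g + 1) * Z ^ g * X ^ (-(1 : ℝ) / 2)⌋₊
  refine ⟨(Finset.range (S + 1) ×ˢ Finset.range (U + 1) ×ˢ Finset.range (V + 1)).filter fun t =>
    Z ^ 2 ≤ (t.1 : ℝ) ∧ (t.1 : ℝ) < 4 * Z ^ 2 ∧
    0 < t.2.1 ∧ (t.2.1 : ℝ) ≤ 2 ^ (g + 1) * Z ^ g ∧
    0 < t.2.2 ∧ (t.2.2 : ℝ) ≤ 2 ^ (g + 1) * Z ^ g * X ^ (-(1 : ℝ) / 2) ∧
    Nat.gcd t.1 t.2.2 = 1 ∧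
    (∃ p₁ p₂ : ℕ, p₁.Prime ∧ p₂.Prime ∧ p₁ ≠ p₂ ∧
      Z ≤ p₁ ∧ (p₁ : ℝ) < 2 * Z ∧ Z ≤ p₂ ∧ (p₂ : ℝ) < 2 * Z ∧ t.1 = p₁ * p₂) ∧
    4 * (t.1 : ℤ) ^ g = (t.2.1 : ℤ) ^ 2 + (d : ℤ) * (t.2.2 : ℤ) ^ 2, ?_, fun t ht => ?_⟩
  · refine Nat.subtype_card _ fun t => ?_
    simp only [Finset.mem_filter, Finset.mem_product, Finset.mem_range, Nat.lt_succ_iff,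
      and_iff_right_iff_imp]
    rintro ⟨-, h₁, -, h₂, -, h₃, -⟩
    exact ⟨Nat.le_floor h₁.le, Nat.le_floor h₂, Nat.le_floor h₃⟩
  · obtain ⟨-, h₀, h₁, h₂, h₃, h₄, h₅, h₆, h₇, h₈⟩ := Finset.mem_filter.1 ht
    refine ⟨⟨?_, Nat.le_floor h₁.le, h₂, Nat.le_floor h₃, h₄, Nat.le_floor h₅, h₆, ?_⟩, h₇⟩
    · have : (0 : ℝ) < t.1 := lt_of_lt_of_le (by positivity) h₀
      exact_mod_cast this
    · exact_mod_cast h₈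

theorem Tg_eq_card (g : ℕ) {Z : ℝ} (hZ : 1 ≤ Z) (X : ℝ) :
    ∃ P : Finset ((ℕ × ℕ × ℕ) × (ℕ × ℕ × ℕ)), Tg g Z X = P.card ∧ ∀ p ∈ P,
      IsRepPair g ⌊4 * Z ^ 2⌋₊ ⌊2 ^ (g + 1) * Z ^ g⌋₊
        ⌊2 ^ (g + 1) * Z ^ g * X ^ (-(1 : ℝ) / 2)⌋₊ p ∧
        IsPrimeProduct Z p.1.1 ∧ IsPrimeProduct Z p.2.1 := by
  classical
  choose A hA hrep using fun d => Rg_eq_card g d hZ X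
  refine ⟨((Finset.range (⌈2 * X⌉₊ + 1)).filter
    (fun d : ℕ => Squarefree d ∧ X ≤ (d : ℝ) ∧ (d : ℝ) < 2 * X)).biUnion fun d => (A d).offDiag,
    ?_, fun p hp => ?_⟩
  · rw [Finset.card_biUnion, Tg, Nat.cast_sum]
    · refine Finset.sum_congr rfl fun d _ => ?_
      rw [hA d, Finset.offDiag_card, Nat.cast_sub (Nat.le_mul_self _)]
      push_cast
      ring
    · intro d _ d' _ hdd
      refine Finset.disjoint_left.2 fun p hp hp' => hdd ?_
      have h := (hrep d p.1 (Finset.mem_offDiag.1 hp).1).1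
      have h' := (hrep d' p.1 (Finset.mem_offDiag.1 hp').1).1
      have he := Nat.add_left_cancel (h.eqn.symm.trans h'.eqn)
      exact Nat.eq_of_mul_eq_mul_right (pow_pos h.v_pos 2) he
  · obtain ⟨d, -, hp⟩ := Finset.mem_biUnion.1 hp
    obtain ⟨h₁, h₂, hne⟩ := Finset.mem_offDiag.1 hp
    exact ⟨⟨hne, d, (hrep d _ h₁).1, (hrep d _ h₂).1⟩, (hrep d _ h₁).2, (hrep d _ h₂).2⟩

/-- Divisor and logarithm bounds for all the integers that occur in the box of `Rg g d Z X`. -/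
theorem exists_box_bounds (g : ℕ) {ε : ℝ} (hε : 0 < ε) :
    ∃ K : ℝ, 1 ≤ K ∧ ∀ X Z : ℝ, 1 ≤ X → 1 ≤ Z → Z ≤ X → ∀ S U V : ℕ, (S : ℝ) ≤ 4 * Z ^ 2 →
      (U : ℝ) ≤ 2 ^ (g + 1) * Z ^ g → (V : ℝ) ≤ 2 ^ (g + 1) * Z ^ g * X ^ (-(1 : ℝ) / 2) →
      ∀ n : ℕ, n ≠ 0 → n ≤ 8 * S ^ g * V ^ 2 + U * V →
        (n.divisors.card : ℝ) ≤ K * X ^ ε ∧ 1 + Real.log n ≤ K * X ^ ε := by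
  obtain ⟨K, hK1, hK⟩ := exists_card_divisors_le_of_le_pow (4 * g)
    (8 * 4 ^ g * (2 ^ (g + 1)) ^ 2 + (2 ^ (g + 1)) ^ 2) hε
  refine ⟨K, hK1, fun X Z hX hZ hZX S U V hS hU hV n hn hnB => hK X hX n hn ?_⟩
  have hX0 : 0 < X := by linarith
  have hV' : (V : ℝ) ≤ 2 ^ (g + 1) * X ^ g := by
    refine hV.trans ?_
    calc _ ≤ 2 ^ (g + 1) * Z ^ g * 1 := by
          gcongr
          exact Real.rpow_le_one_of_one_le_of_nonpos hX (by norm_num)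
      _ ≤ _ := by rw [mul_one]; gcongr
  have hU' : (U : ℝ) ≤ 2 ^ (g + 1) * X ^ g := hU.trans (by gcongr)
  have hS' : (S : ℝ) ≤ 4 * X ^ 2 := hS.trans (by gcongr)
  calc (n : ℝ) ≤ 8 * (S : ℝ) ^ g * (V : ℝ) ^ 2 + U * V := by exact_mod_cast hnB
    _ ≤ 8 * (4 * X ^ 2) ^ g * (2 ^ (g + 1) * X ^ g) ^ 2 +
        (2 ^ (g + 1) * X ^ g) * (2 ^ (g + 1) * X ^ g) := by gcongr
    _ = 8 * 4 ^ g * (2 ^ (g + 1)) ^ 2 * X ^ (4 * g) + (2 ^ (g + 1)) ^ 2 * X ^ (2 * g) := by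
        rw [mul_pow 4, ← pow_mul X 2 g]
        ring
    _ ≤ 8 * 4 ^ g * (2 ^ (g + 1)) ^ 2 * X ^ (4 * g) + (2 ^ (g + 1)) ^ 2 * X ^ (4 * g) := by
        gcongr
        norm_num
    _ = _ := by ring

theorem exists_Tg_le {g : ℕ} (hg : g ≠ 0) {ε : ℝ} (hε : 0 < ε) :
    ∃ C : ℝ, 0 < C ∧ ∀ X Z : ℝ, 1 ≤ X → 1 ≤ Z → Z ≤ X →
      Tg g Z X ≤ C * Z ^ (2 * g + 4) * X ^ (ε - 1) := by
  obtain ⟨K, hK1, hK⟩ := exists_box_bounds g hε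
  refine ⟨16 * 4 ^ (g + 1) * K, by positivity, fun X Z hX hZ hZX => ?_⟩
  obtain ⟨P, hTP, hP⟩ := Tg_eq_card g hZ X
  have hX0 : 0 < X := by linarith
  have hS := Nat.floor_le (show 0 ≤ 4 * Z ^ 2 by positivity)
  have hU := Nat.floor_le (show 0 ≤ 2 ^ (g + 1) * Z ^ g by positivity)
  have hV := Nat.floor_le (show 0 ≤ 2 ^ (g + 1) * Z ^ g * X ^ (-(1 : ℝ) / 2) by positivity)
  set S := ⌊4 * Z ^ 2⌋₊
  set U := ⌊2 ^ (g + 1) * Z ^ g⌋₊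
  set V := ⌊2 ^ (g + 1) * Z ^ g * X ^ (-(1 : ℝ) / 2)⌋₊
  have hcard := card_repPairs_le (D := ⌊K * X ^ ε⌋₊) hg
    (fun n hn hnB => Nat.le_floor (hK X Z hX hZ hZX S U V hS hU hV n hn hnB).1) P
    (fun p hp => (hP p hp).1) (Finset.Icc 1 S ×ˢ Finset.Icc 1 S) (Finset.Icc 1 V ×ˢ Finset.Icc 1 V)
    (fun p hp => by
      obtain ⟨-, d, h₁, h₂⟩ := (hP p hp).1
      simp only [Finset.mem_product, Finset.mem_Icc]
      exact ⟨⟨h₁.w_pos, h₁.w_le⟩, h₂.w_pos, h₂.w_le⟩)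
    fun p hp => by
      obtain ⟨-, d, h₁, h₂⟩ := (hP p hp).1
      simp only [Finset.mem_product, Finset.mem_Icc]
      exact ⟨⟨h₁.v_pos, h₁.v_le⟩, h₂.v_pos, h₂.v_le⟩
  simp only [Finset.card_product, Nat.card_Icc, Nat.add_sub_cancel] at hcard
  rw [hTP]
  calc (P.card : ℝ) ≤ (⌊K * X ^ ε⌋₊ : ℝ) * ((S * S) * (V * V)) := by exact_mod_cast hcard
    _ ≤ (K * X ^ ε) * ((4 * Z ^ 2 * (4 * Z ^ 2)) *
        ((2 ^ (g + 1) * Z ^ g * X ^ (-(1 : ℝ) / 2)) *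
          (2 ^ (g + 1) * Z ^ g * X ^ (-(1 : ℝ) / 2)))) := by
        gcongr
        exact Nat.floor_le (by positivity)
    _ = 16 * ((2 ^ (g + 1)) * (2 ^ (g + 1))) * K * Z ^ (2 * g + 4) *
        (X ^ ε * (X ^ (-(1 : ℝ) / 2) * X ^ (-(1 : ℝ) / 2))) := by ring
    _ = _ := by
        rw [← mul_pow, ← Real.rpow_add hX0, ← Real.rpow_add hX0]
        rw [show ε + (-(1 : ℝ) / 2 + -(1 : ℝ) / 2) = ε - 1 by ring]
        norm_num

theorem primeProductPairs_three_bound_le {Z L v s t d : ℝ} (hZ : 1 ≤ Z) (hL : 1 ≤ L) (hv : 1 ≤ v)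
    {S U V : ℝ} (hS0 : 0 ≤ S) (hU0 : 0 ≤ U) (hV0 : 0 ≤ V) (hd0 : 0 ≤ d)
    (hS : S ≤ 4 * Z ^ 2) (hU : U ≤ 16 * Z ^ 3) (hV : V ≤ v) (hd : d ≤ L) (hs0 : 0 ≤ s) (hs : s ≤ L)
    (ht0 : 0 ≤ t) (ht : t ≤ L) :
    d * (S ^ 2 * (12 * V * t)) + d * (27 * Z ^ 3 * V ^ 2) +
      d ^ 6 * (V ^ 2 * (2 * (U * V) + 1) + 4 * S ^ 2 * (2 * d ^ 2 * V * (12 * s))) ≤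
    L ^ 9 * (1728 * (Z ^ 4 * v) + 60 * (Z ^ 3 * v ^ 3)) := by
  have hZ3 : 1 ≤ Z ^ 3 := one_le_pow₀ hZ
  have h₁ : d * (S ^ 2 * (12 * V * t)) ≤ L ^ 9 * (192 * (Z ^ 4 * v)) := by
    calc _ ≤ L * ((4 * Z ^ 2) ^ 2 * (12 * v * L)) := by gcongr
      _ = L ^ 2 * (192 * (Z ^ 4 * v)) := by ring
      _ ≤ _ := by gcongr; norm_num
  have h₂ : d * (27 * Z ^ 3 * V ^ 2) ≤ L ^ 9 * (27 * (Z ^ 3 * v ^ 3)) := by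
    calc _ ≤ L * (27 * Z ^ 3 * v ^ 2) := by gcongr
      _ = L ^ 1 * (27 * (Z ^ 3 * v ^ 2)) := by ring
      _ ≤ _ := by gcongr <;> norm_num
  have h₃ : d ^ 6 * (V ^ 2 * (2 * (U * V) + 1)) ≤ L ^ 9 * (33 * (Z ^ 3 * v ^ 3)) := by
    have : 1 ≤ Z ^ 3 * v := one_le_mul_of_one_le_of_one_le hZ3 hv
    calc _ ≤ L ^ 6 * (v ^ 2 * (2 * (16 * Z ^ 3 * v) + Z ^ 3 * v)) := by gcongr
      _ = L ^ 6 * (33 * (Z ^ 3 * v ^ 3)) := by ring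
      _ ≤ _ := by gcongr; norm_num
  have h₄ : d ^ 6 * (4 * S ^ 2 * (2 * d ^ 2 * V * (12 * s))) ≤ L ^ 9 * (1536 * (Z ^ 4 * v)) := by
    calc _ ≤ L ^ 6 * (4 * (4 * Z ^ 2) ^ 2 * (2 * L ^ 2 * v * (12 * L))) := by gcongr
      _ = _ := by ring
  linarith

theorem exists_Tg_three_le {ε : ℝ} (hε : 0 < ε) :
    ∃ C : ℝ, 0 < C ∧ ∀ X Z : ℝ, 1 ≤ X → 1 ≤ Z → Z ≤ X →
      Tg 3 Z X ≤
        C * X ^ ε * (Z ^ 7 * X ^ (-(1 : ℝ) / 2) + Z ^ 12 * X ^ (-(3 : ℝ) / 2)) := by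
  obtain ⟨K, hK1, hK⟩ := exists_box_bounds 3 (show 0 < ε / 9 by positivity)
  refine ⟨K ^ 9 * (60 * 4096), by positivity, fun X Z hX hZ hZX => ?_⟩
  obtain ⟨P, hTP, hP⟩ := Tg_eq_card 3 hZ X
  have hX0 : 0 < X := by linarith
  have hS := Nat.floor_le (show 0 ≤ 4 * Z ^ 2 by positivity)
  have hU := Nat.floor_le (show 0 ≤ 2 ^ (3 + 1) * Z ^ 3 by positivity)
  have hV := Nat.floor_le (show 0 ≤ 2 ^ (3 + 1) * Z ^ 3 * X ^ (-(1 : ℝ) / 2) by positivity)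
  have hSpos : 0 < ⌊4 * Z ^ 2⌋₊ := Nat.floor_pos.2 (by nlinarith)
  set v := 2 ^ (3 + 1) * Z ^ 3 * X ^ (-(1 : ℝ) / 2) with hv
  set S := ⌊4 * Z ^ 2⌋₊
  set U := ⌊2 ^ (3 + 1) * Z ^ 3⌋₊
  set V := ⌊v⌋₊
  set L := K * X ^ (ε / 9) with hL
  have hL1 : 1 ≤ L := one_le_mul_of_one_le_of_one_le hK1 (Real.one_le_rpow hX (by positivity))
  have hL9 : L ^ 9 = K ^ 9 * X ^ ε := by
    rw [hL, mul_pow, ← Real.rpow_natCast (X ^ (ε / 9)), ← Real.rpow_mul hX0.le]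
    norm_num
  rw [hTP]
  rcases Nat.eq_zero_or_pos V with hV0 | hVpos
  · have : P = ∅ := Finset.eq_empty_of_forall_notMem fun p hp => by
      obtain ⟨-, d, h, -⟩ := (hP p hp).1
      exact absurd (h.v_pos.trans_le h.v_le) (by omega)
    rw [this]
    simp only [Finset.card_empty, Nat.cast_zero]
    positivity
  have hv1 : 1 ≤ v := (Nat.floor_pos).1 hVpos
  have hbounds := hK X Z hX hZ hZX S U V hS hU hV
  have hSV : S ≤ 8 * S ^ 3 * V ^ 2 + U * V ∧ V ≤ 8 * S ^ 3 * V ^ 2 + U * V := by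
    have h₁ : S ≤ S ^ 3 := Nat.le_self_pow three_ne_zero _
    have h₂ : V ≤ V ^ 2 := Nat.le_self_pow two_ne_zero _
    constructor <;> nlinarith [Nat.zero_le (U * V)]
  have hcard := card_primeProductPairs_three_le (D := ⌊L⌋₊) hZ
    (fun n hn hnB => Nat.le_floor (hbounds n hn hnB).1) P hP
  refine hcard.trans ((primeProductPairs_three_bound_le hZ hL1 hv1 (by positivity) (by positivity)
    (by positivity) (by positivity) hS (hU.trans_eq (by norm_num)) hV
    (Nat.floor_le (by positivity)) ?_ (hbounds S hSpos.ne' hSV.1).2 ?_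
    (hbounds V hVpos.ne' hSV.2).2).trans ?_)
  · have := Real.log_natCast_nonneg S
    positivity
  · have := Real.log_natCast_nonneg V
    positivity
  · have e₁ : Z ^ 4 * v = 16 * (Z ^ 7 * X ^ (-(1 : ℝ) / 2)) := by rw [hv]; ring
    have e₂ : Z ^ 3 * v ^ 3 = 4096 * (Z ^ 12 * X ^ (-(3 : ℝ) / 2)) := by
      have : (X ^ (-(1 : ℝ) / 2)) ^ 3 = X ^ (-(3 : ℝ) / 2) := by
        rw [← Real.rpow_natCast, ← Real.rpow_mul hX0.le]
        norm_num
      rw [hv, mul_pow, this]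
      ring
    rw [hL9, e₁, e₂]
    have h₁ : 0 ≤ Z ^ 7 * X ^ (-(1 : ℝ) / 2) := by positivity
    rw [mul_right_comm (K ^ 9) (60 * 4096), mul_assoc (K ^ 9 * X ^ ε) (60 * 4096)]
    gcongr
    linarith

/-- Fix a prime `g ≥ 3`.  For every `ε > 0` there is `C = C(g, ε)` such that for
all `X ≥ 2`: (i) for `X^(1/(2g)) ≤ Z ≤ X` one has
`T_g(Z;X) ≤ C·Z^(2g+4)·X^(ε-1)`; and (ii) if `g = 3`, for `X^(1/6) ≤ Z ≤ X` one
has `T_3(Z;X) ≤ C·X^ε·(Z^7·X^(-1/2) + Z^12·X^(-3/2))`. -/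
theorem Tg_bound (g : ℕ) (hg : g.Prime) (hg3 : 3 ≤ g) (ε : ℝ) (hε : 0 < ε) :
    ∃ C : ℝ, 0 < C ∧ ∀ X : ℝ, 2 ≤ X →
      (∀ Z : ℝ, X ^ ((1 : ℝ) / (2 * g)) ≤ Z → Z ≤ X →
        Tg g Z X ≤ C * Z ^ (2 * g + 4) * X ^ (ε - 1)) ∧
      (g = 3 → ∀ Z : ℝ, X ^ ((1 : ℝ) / 6) ≤ Z → Z ≤ X →
        Tg 3 Z X ≤ C * X ^ ε * (Z ^ 7 * X ^ (-(1 : ℝ) / 2) + Z ^ 12 * X ^ (-(3 : ℝ) / 2))) := by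
  obtain ⟨C₁, hC₁, h₁⟩ := exists_Tg_le hg.ne_zero hε
  obtain ⟨C₂, hC₂, h₂⟩ := exists_Tg_three_le hε
  refine ⟨C₁ + C₂, by positivity, fun X hX => ⟨fun Z hXZ hZX => ?_, fun _ Z hXZ hZX => ?_⟩⟩
  · have hZ : 1 ≤ Z := (Real.one_le_rpow (by linarith) (by positivity)).trans hXZ
    refine (h₁ X Z (by linarith) hZ hZX).trans ?_
    gcongr
    linarith
  · have hZ : 1 ≤ Z := (Real.one_le_rpow (by linarith) (by positivity)).trans hXZ
    refine (h₂ X Z (by linarith) hZ hZX).trans ?_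
    gcongr
    linarith
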